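/- Let μ ∈ ℤⁿ. The multiplication map m(y₁,y₂) := π(y₁·y₂) and the map F_α(y) := (ξ_α(y), π(ξ_α(y)^{−1}·y)) are well-defined mutually inverse bijections between Gr⁰_{−α} × Gr_{μ+α} and the locus {y ∈ Gr_μ : Φ_{α,k}(y) ≠ 0}: m∘F_α is the identity of {y ∈ Gr_μ : Φ_{α,k}(y) ≠ 0} and F_α∘m is the identity of Gr⁰_{−α} × Gr_{μ+α}. -/

import Mathlib

open Matrix

noncomputable section

/-- `K = ℂ((t⁻¹))`, the field of formal Laurent series in `t⁻¹`.  We realize it as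
`LaurentSeries ℂ`, where the Laurent-series variable `X` plays the role of `t⁻¹`;
thus for `f : K`, `f.coeff j` is the coefficient of `t^{-j}`. -/
abbrev K : Type := LaurentSeries ℂ

/-- The element `t` (the inverse of the Laurent series variable). -/
def tK : K := (HahnSeries.single (-1 : ℤ) (1 : ℂ))

/-- The constant embedding `ℂ → K`. -/
def Cc (z : ℂ) : K := HahnSeries.C z

/-- `f ∈ 𝒪 = ℂ[[t⁻¹]]` : no positive powers of `t`. -/
def memO (f : K) : Prop := ∀ j : ℤ, j < 0 → f.coeff j = 0

/-- `f ∈ 𝒪₁ = t⁻¹ℂ[[t⁻¹]]`. -/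
def memO1 (f : K) : Prop := ∀ j : ℤ, j ≤ 0 → f.coeff j = 0

/-- `f ∈ ℂ[t]`. -/
def memPoly (f : K) : Prop := ∀ j : ℤ, 0 < j → f.coeff j = 0

/-- Upper unitriangular matrix. -/
def IsUpperUni {R : Type*} [Zero R] [One R] {m : ℕ} (M : Matrix (Fin m) (Fin m) R) : Prop :=
  (∀ i, M i i = 1) ∧ ∀ i j : Fin m, j < i → M i j = 0

/-- Lower unitriangular matrix. -/
def IsLowerUni {R : Type*} [Zero R] [One R] {m : ℕ} (M : Matrix (Fin m) (Fin m) R) : Prop :=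
  (∀ i, M i i = 1) ∧ ∀ i j : Fin m, i < j → M i j = 0

/-- `M ∈ N₁[[t⁻¹]]` : upper unitriangular with off-diagonal entries in `𝒪₁`. -/
def MemN1 {m : ℕ} (M : Matrix (Fin m) (Fin m) K) : Prop :=
  IsUpperUni M ∧ ∀ i j : Fin m, i ≠ j → memO1 (M i j)

/-- `M ∈ N₋,₁[[t⁻¹]]`. -/
def MemN1neg {m : ℕ} (M : Matrix (Fin m) (Fin m) K) : Prop :=
  IsLowerUni M ∧ ∀ i j : Fin m, i ≠ j → memO1 (M i j)

/-- `M ∈ T₁[[t⁻¹]]` : diagonal with entries in `1 + 𝒪₁`. -/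
def MemT1 {m : ℕ} (M : Matrix (Fin m) (Fin m) K) : Prop :=
  (∀ i j : Fin m, i ≠ j → M i j = 0) ∧ ∀ i, memO1 (M i i - 1)

/-- `M ∈ N[t]` : upper unitriangular with entries in `ℂ[t]`. -/
def MemNpoly {m : ℕ} (M : Matrix (Fin m) (Fin m) K) : Prop :=
  IsUpperUni M ∧ ∀ i j : Fin m, memPoly (M i j)

/-- `M ∈ N₋[t]` : lower unitriangular with entries in `ℂ[t]`. -/
def MemNnegPoly {m : ℕ} (M : Matrix (Fin m) (Fin m) K) : Prop :=
  IsLowerUni M ∧ ∀ i j : Fin m, memPoly (M i j)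

/-- `t^ν = diag(t^{ν₁},…,t^{ν_m})`. -/
def tPow {m : ℕ} (ν : Fin m → ℤ) : Matrix (Fin m) (Fin m) K :=
  Matrix.diagonal fun i => tK ^ ν i

/-- `y = u · h · t^ν · l` is a Gauss factorization exhibiting membership in `Gr_ν`. -/
def IsGauss {m : ℕ} (ν : Fin m → ℤ) (y u h l : Matrix (Fin m) (Fin m) K) : Prop :=
  MemN1 u ∧ MemT1 h ∧ MemN1neg l ∧ y = u * h * tPow ν * l

/-- The matrix slice `Gr_ν = N₁[[t⁻¹]]·T₁[[t⁻¹]]·t^ν·N₋,₁[[t⁻¹]]`. -/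
def GrSlice {m : ℕ} (ν : Fin m → ℤ) : Set (Matrix (Fin m) (Fin m) K) :=
  { y | ∃ u h l, IsGauss ν y u h l }

/-- Block embedding `τ_α : Mat_{k+1} → Mat_n` into (1-indexed) rows and columns `r₁,…,r₁+k`,
identity outside this block. -/
def blockEmbed {R : Type*} [Zero R] [One R] (n r₁ k : ℕ)
    (g : Matrix (Fin (k+1)) (Fin (k+1)) R) : Matrix (Fin n) (Fin n) R :=
  fun i j =>
    if h : r₁ - 1 ≤ (i : ℕ) ∧ (i : ℕ) ≤ r₁ - 1 + k ∧ r₁ - 1 ≤ (j : ℕ) ∧ (j : ℕ) ≤ r₁ - 1 + k then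
      g ⟨(i : ℕ) - (r₁ - 1), by omega⟩ ⟨(j : ℕ) - (r₁ - 1), by omega⟩
    else if i = j then 1 else 0

/-- The coweight `α` of `PGL_n` : `α_{r₁} = 1`, `α_{r₂+1} = -1` (1-indexed), all other
entries `0`. -/
def alphaCo (n r₁ r₂ : ℕ) : Fin n → ℤ :=
  fun i => if (i : ℕ) = r₁ - 1 then 1 else if (i : ℕ) = r₂ then -1 else 0

/-- The matrix `y(p,e,b,g)` (matrix representative of a point of the open Zastava
`Gr⁰_{-α}`), a `(k+1)×(k+1)` matrix over `ℂ[t] ⊆ K`. -/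
def ymat (k : ℕ) (p e : ℂ) (b g : Fin (k-1) → ℂ) :
    Matrix (Fin (k+1)) (Fin (k+1)) K :=
  fun i j =>
    if _hi0 : (i : ℕ) = 0 then
      (if _hjk : (j : ℕ) = k then Cc e else 0)
    else if _hik : (i : ℕ) = k then
      (if _hj0 : (j : ℕ) = 0 then Cc (-e⁻¹)
       else if _hjk : (j : ℕ) = k then tK - Cc (p + ∑ l : Fin (k-1), b l * g l)
       else Cc (-(g ⟨k - (j : ℕ) - 1, by have := j.isLt; omega⟩)))
    else
      (if _hji : (j : ℕ) = (i : ℕ) then 1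
       else if _hjk : (j : ℕ) = k then Cc (b ⟨k - (i : ℕ) - 1, by have := i.isLt; omega⟩)
       else 0)

/-- The matrix `x₋(v)` over `K` : identity except for the bottom row `(v_k,…,v₁,1)`. -/
def xminusK (k : ℕ) (v : Fin k → ℂ) : Matrix (Fin (k+1)) (Fin (k+1)) K :=
  fun i j =>
    if _hik : (i : ℕ) = k then
      (if _hjk : (j : ℕ) = k then 1 else Cc (v ⟨k - (j : ℕ) - 1, by have := j.isLt; omega⟩))
    else if i = j then 1 else 0

/-- `Φ_α(y)` read off from the `N₁[[t⁻¹]]`-factor `u` of a Gauss factorization of `y`. -/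
def PhiOf (n r₂ k : ℕ) (hrn : r₂ < n) (u : Matrix (Fin n) (Fin n) K) : Fin k → ℂ :=
  fun a => (u ⟨r₂ - 1 - (a : ℕ), by omega⟩ ⟨r₂, hrn⟩).coeff 1

/-- `ζ_α(y)` read off from the `N₁[[t⁻¹]]`-factor `u` of a Gauss factorization of `y`. -/
def ZetaOf (n r₁ r₂ k : ℕ) (hr1 : 1 ≤ r₁) (hrr : r₁ ≤ r₂) (hrn : r₂ < n)
    (hk : k = r₂ - r₁ + 1) (u : Matrix (Fin n) (Fin n) K) : Fin k → ℂ :=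
  fun a =>
    if _ha : (a : ℕ) = k - 1 then (u ⟨r₁ - 1, by omega⟩ ⟨r₂, hrn⟩).coeff 2
    else (u ⟨r₁ - 1, by omega⟩ ⟨r₁ + (a : ℕ), by have := a.isLt; omega⟩).coeff 1

/-- `ξ_α(y)`, computed from the `N₁[[t⁻¹]]`-factor `u` of a Gauss factorization of `y`. -/
def xiOf (n r₁ r₂ k : ℕ) (hr1 : 1 ≤ r₁) (hrr : r₁ ≤ r₂) (hrn : r₂ < n)
    (hk : k = r₂ - r₁ + 1) (u : Matrix (Fin n) (Fin n) K) : Matrix (Fin n) (Fin n) K :=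
  let c := PhiOf n r₂ k hrn u
  let z := ZetaOf n r₁ r₂ k hr1 hrr hrn hk u
  let e : ℂ := c ⟨k - 1, by omega⟩
  let b : Fin (k-1) → ℂ := fun i => c ⟨(i : ℕ), by have := i.isLt; omega⟩
  let g : Fin (k-1) → ℂ := fun i => z ⟨k - (i : ℕ) - 2, by omega⟩ / e
  let p : ℂ := z ⟨k - 1, by omega⟩ / e - ∑ i : Fin (k-1), b i * g i
  blockEmbed n r₁ k (ymat k p e b g)

/-- `M` has identity submatrix in (1-indexed) rows and columns `r₁,…,r₁+k`. -/
def HasIdBlock {R : Type*} [Zero R] [One R] {n : ℕ} (r₁ k : ℕ)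
    (M : Matrix (Fin n) (Fin n) R) : Prop :=
  ∀ i j : Fin n, r₁ - 1 ≤ (i : ℕ) → (i : ℕ) ≤ r₁ - 1 + k →
    r₁ - 1 ≤ (j : ℕ) → (j : ℕ) ≤ r₁ - 1 + k →
    M i j = if i = j then 1 else 0

/-- `M ∈ N^α(K)` : upper unitriangular over `K` with identity `(k+1)×(k+1)`-block. -/
def MemNalphaK (n r₁ k : ℕ) (M : Matrix (Fin n) (Fin n) K) : Prop :=
  IsUpperUni M ∧ HasIdBlock r₁ k M

/-- `M ∈ N^α[t]`. -/
def MemNalphaPoly (n r₁ k : ℕ) (M : Matrix (Fin n) (Fin n) K) : Prop :=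
  MemNalphaK n r₁ k M ∧ ∀ i j : Fin n, memPoly (M i j)

/-- `M ∈ N(K)^α₁ = x_α(N_{1,k+1}[[t⁻¹]])·N^α(K)`. -/
def MemNKalpha1 (n r₁ k : ℕ) (M : Matrix (Fin n) (Fin n) K) : Prop :=
  ∃ (a : Matrix (Fin (k+1)) (Fin (k+1)) K) (u : Matrix (Fin n) (Fin n) K),
    MemN1 a ∧ MemNalphaK n r₁ k u ∧ M = blockEmbed n r₁ k a * u

/-- `z = π(x)` for the slice `Gr_ν` : `z ∈ Gr_ν` and `z = a·x·b` with `a ∈ N[t]`,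
`b ∈ N₋[t]`. -/
def IsPiOf {n : ℕ} (ν : Fin n → ℤ) (x z : Matrix (Fin n) (Fin n) K) : Prop :=
  z ∈ GrSlice ν ∧ ∃ a b, MemNpoly a ∧ MemNnegPoly b ∧ z = a * x * b

/-- The open Zastava slice `Gr⁰_{-α} ⊆ GL_n(K)` : matrices `τ_α(y(p,e,b,g))`. -/
def GrZeroNegAlpha (n r₁ k : ℕ) : Set (Matrix (Fin n) (Fin n) K) :=
  { M | ∃ (p e : ℂ) (b g : Fin (k-1) → ℂ), e ≠ 0 ∧ M = blockEmbed n r₁ k (ymat k p e b g) }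

/-- `μ + α`. -/
def addAlpha (n r₁ r₂ : ℕ) (μ : Fin n → ℤ) : Fin n → ℤ :=
  fun i => μ i + alphaCo n r₁ r₂ i


open Classical in
/-- `π(x)` for the slice `Gr_ν` (the element of `Gr_ν` of the form `a·x·c` with
`a ∈ N[t]`, `c ∈ N₋[t]`; it is unique when it exists). -/
noncomputable def piF {n : ℕ} (ν : Fin n → ℤ) (x : Matrix (Fin n) (Fin n) K) :
    Matrix (Fin n) (Fin n) K :=
  if h : ∃ z, IsPiOf ν x z then h.choose else 0

open Classical in
/-- The `N₁[[t⁻¹]]`-factor of the Gauss factorization of `y ∈ Gr_ν`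
(unique when it exists). -/
noncomputable def gaussUF {n : ℕ} (ν : Fin n → ℤ) (y : Matrix (Fin n) (Fin n) K) :
    Matrix (Fin n) (Fin n) K :=
  if h : ∃ u, ∃ hh l, IsGauss ν y u hh l then h.choose else 1

/-- `Φ_α : Gr_ν → ℂ^k`. -/
noncomputable def PhiF (n r₂ k : ℕ) (hrn : r₂ < n) (ν : Fin n → ℤ)
    (y : Matrix (Fin n) (Fin n) K) : Fin k → ℂ :=
  PhiOf n r₂ k hrn (gaussUF ν y)

/-- `ξ_α : Gr_ν → Gr⁰_{−α}`. -/
noncomputable def xiF (n r₁ r₂ k : ℕ) (hr1 : 1 ≤ r₁) (hrr : r₁ ≤ r₂) (hrn : r₂ < n)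
    (hk : k = r₂ - r₁ + 1) (ν : Fin n → ℤ) (y : Matrix (Fin n) (Fin n) K) :
    Matrix (Fin n) (Fin n) K :=
  xiOf n r₁ r₂ k hr1 hrr hrn hk (gaussUF ν y)

theorem memO1_iff (f : K) : memO1 f ↔ ∀ j < (1 : ℤ), f.coeff j = 0 := by
  simp only [memO1, Int.lt_iff_add_one_le, add_le_iff_nonpos_left]

/-- The subgroup `t^{-m}ℂ[[t⁻¹]]` of `K`. -/
def filt (m : ℤ) : AddSubgroup K where
  carrier := {f | ∀ j < m, f.coeff j = 0}
  add_mem' hx hy j hj := by simp [hx j hj, hy j hj]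
  zero_mem' j _ := rfl
  neg_mem' hx j hj := by simp [hx j hj]

theorem memO1_iff_mem_filt {f : K} : memO1 f ↔ f ∈ filt 1 := memO1_iff f

theorem filt_mono {a b : ℤ} (h : a ≤ b) {x : K} (hx : x ∈ filt b) : x ∈ filt a :=
  fun j hj => hx j (hj.trans_le h)

theorem mul_mem_filt {a b : ℤ} {x y : K} (hx : x ∈ filt a) (hy : y ∈ filt b) :
    x * y ∈ filt (a + b) := by
  intro j hj
  rw [HahnSeries.coeff_mul]
  refine Finset.sum_eq_zero ?_
  rintro ⟨i, k⟩ hik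
  rw [Finset.mem_antidiagonal] at hik
  obtain ⟨-, -, h3⟩ := hik
  by_cases h : i < a
  · simp [hx i h]
  · simp only at h3 ⊢
    rw [hy k (by omega), mul_zero]

theorem mul_mem_filt' {a b c : ℤ} {x y : K} (hx : x ∈ filt a) (hy : y ∈ filt b)
    (h : c ≤ a + b := by norm_num) : x * y ∈ filt c :=
  filt_mono h (mul_mem_filt hx hy)

theorem Cc_mem_filt (z : ℂ) : Cc z ∈ filt 0 := by
  intro j hj
  simp [Cc, HahnSeries.C_apply, HahnSeries.coeff_single_of_ne hj.ne]

theorem one_mem_filt : (1 : K) ∈ filt 0 := by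
  have := Cc_mem_filt 1
  simpa [Cc] using this

theorem tK_mem_filt : tK ∈ filt (-1) := by
  intro j hj
  simp [tK, HahnSeries.coeff_single_of_ne hj.ne]

theorem tK_ne_zero : tK ≠ 0 := by
  simp [tK]

theorem tK_inv : tK⁻¹ = HahnSeries.single (1 : ℤ) (1 : ℂ) := by
  rw [inv_eq_iff_eq_inv, eq_comm, inv_eq_of_mul_eq_one_left]
  simp [tK]

theorem tK_inv_mem_filt : tK⁻¹ ∈ filt 1 := by
  intro j hj
  rw [tK_inv, HahnSeries.coeff_single_of_ne hj.ne]

theorem coeff_Cc_mul (z : ℂ) (f : K) (j : ℤ) : (Cc z * f).coeff j = z * f.coeff j := by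
  simp [Cc]

theorem coeff_tK_mul (f : K) (j : ℤ) : (tK * f).coeff j = f.coeff (j + 1) := by
  have := HahnSeries.coeff_single_mul_add (r := (1 : ℂ)) (x := f) (a := j + 1) (b := -1)
  simpa [tK] using this

theorem coeff_tK_inv_mul (f : K) (j : ℤ) : (tK⁻¹ * f).coeff j = f.coeff (j - 1) := by
  have := coeff_tK_mul (tK⁻¹ * f) (j - 1)
  rw [mul_inv_cancel_left₀ tK_ne_zero] at this
  simpa using this.symm

theorem coeff_Cc_zero (z : ℂ) : (Cc z).coeff 0 = z := by simp [Cc, HahnSeries.C_apply]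

theorem sub_Cc_mem_filt {f : K} (hf : f ∈ filt 0) : f - Cc (f.coeff 0) ∈ filt 1 := by
  intro j hj
  rcases (show j < 0 ∨ j = 0 by omega) with h | rfl
  · simp [hf j h, Cc_mem_filt (f.coeff 0) j h]
  · simp [coeff_Cc_zero]

theorem tK_mul_sub_Cc_mem_filt {f : K} (hf : f ∈ filt 1) : tK * f - Cc (f.coeff 1) ∈ filt 1 := by
  have := sub_Cc_mem_filt (f := tK * f) (mul_mem_filt' tK_mem_filt hf)
  rwa [coeff_tK_mul] at this

/-- Inversion preserves `1 + 𝒪₁`. -/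
theorem inv_sub_one_mem_filt {f : K} (hf : f - 1 ∈ filt 1) : f ≠ 0 ∧ f⁻¹ - 1 ∈ filt 1 := by
  have h0 : f ∈ filt 0 := by
    have := add_mem (filt_mono zero_le_one hf) one_mem_filt
    simpa using this
  have hc : f.coeff 0 = 1 := by
    have := hf 0 one_pos
    simpa [sub_eq_zero] using this
  have hf0 : f ≠ 0 := by
    rintro rfl
    simp at hc
  refine ⟨hf0, ?_⟩
  have hi : f⁻¹ ∈ filt 0 := by
    have h1 : Valued.v f = WithZero.exp (-(0 : ℤ)) := by
      refine le_antisymm ((LaurentSeries.valuation_le_iff_coeff_lt_eq_zero ℂ).2 h0) ?_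
      by_contra! hlt
      have : Valued.v f ≤ WithZero.exp (-(1 : ℤ)) := by
        rw [← WithZero.lt_mul_exp_iff_le (by simp)]
        simpa [← WithZero.exp_add] using hlt
      have := (LaurentSeries.valuation_le_iff_coeff_lt_eq_zero ℂ).1 this 0 one_pos
      simp [hc] at this
    refine (LaurentSeries.valuation_le_iff_coeff_lt_eq_zero ℂ).1 ?_
    rw [map_inv₀, h1]
    simp
  have : f⁻¹ - 1 = - (f⁻¹ * (f - 1)) := by
    field_simp
    ring
  rw [this]
  exact neg_mem (mul_mem_filt' hi hf)

/-- The ring of integers `ℂ[[t⁻¹]]`. -/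
def intSubring : Subring K where
  __ := filt 0
  one_mem' := one_mem_filt
  mul_mem' hx hy := mul_mem_filt' hx hy

/-- The ring `ℂ[t]` inside `K`. -/
def polySubring : Subring K where
  carrier := {f | memPoly f}
  add_mem' hx hy j hj := by simp [hx j hj, hy j hj]
  zero_mem' j _ := rfl
  neg_mem' hx j hj := by simp [hx j hj]
  one_mem' j hj := by simp [HahnSeries.coeff_one, hj.ne']
  mul_mem' := by
    intro x y hx hy j hj
    rw [HahnSeries.coeff_mul]
    refine Finset.sum_eq_zero ?_
    rintro ⟨i, k⟩ hik
    rw [Finset.mem_antidiagonal] at hik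
    obtain ⟨-, -, h3⟩ := hik
    by_cases h : 0 < i
    · simp [hx i h]
    · simp only at h3 ⊢
      rw [hy k (by omega), mul_zero]

theorem Cc_mem_poly (z : ℂ) : Cc z ∈ polySubring := by
  intro j hj
  simp [Cc, HahnSeries.C_apply, HahnSeries.coeff_single_of_ne hj.ne']

theorem tK_mem_poly : tK ∈ polySubring := by
  intro j hj
  simp [tK, HahnSeries.coeff_single_of_ne (show j ≠ -1 by omega)]

theorem eq_zero_of_mem_poly_of_mem_filt {f : K} (h1 : f ∈ polySubring) (h2 : f ∈ filt 1) :
    f = 0 := by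
  ext j
  by_cases h : 0 < j
  · exact h1 j h
  · exact h2 j (by omega)

theorem exists_poly_sub_mem_filt (f : K) : ∃ p ∈ polySubring, f - p ∈ filt 1 := by
  refine ⟨⟨fun j => if j ≤ 0 then f.coeff j else 0, ?_⟩, ?_, ?_⟩
  · refine f.isPWO_support.mono ?_
    intro j hj
    simp only [Function.mem_support, ne_eq, ite_eq_right_iff, Classical.not_imp] at hj
    exact hj.2
  · intro j hj
    simp [hj]
  · intro j hj
    simp [show j ≤ 0 by omega]

section Unitriangular

variable {n : ℕ}

theorem IsUpperUni.blockTriangular {M : Matrix (Fin n) (Fin n) K} (h : IsUpperUni M) :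
    M.BlockTriangular id := fun i j hij => h.2 i j hij

theorem IsUpperUni.det {M : Matrix (Fin n) (Fin n) K} (h : IsUpperUni M) : M.det = 1 := by
  simp [Matrix.det_of_isUpperTriangular h.blockTriangular, h.1]

theorem IsUpperUni.mul {M N : Matrix (Fin n) (Fin n) K} (hM : IsUpperUni M) (hN : IsUpperUni N) :
    IsUpperUni (M * N) := by
  refine ⟨fun i => ?_, fun i j hij => (hM.blockTriangular.mul hN.blockTriangular) hij⟩
  rw [Matrix.mul_apply, Finset.sum_eq_single i]
  · simp [hM.1, hN.1]
  · intro m _ hm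
    rcases lt_or_gt_of_ne hm with h | h
    · simp [hM.2 i m h]
    · simp [hN.2 m i h]
  · simp

theorem IsUpperUni.mul_inv {M : Matrix (Fin n) (Fin n) K} (h : IsUpperUni M) : M * M⁻¹ = 1 :=
  Matrix.mul_nonsing_inv _ (by simp [h.det])

theorem IsUpperUni.inv_mul {M : Matrix (Fin n) (Fin n) K} (h : IsUpperUni M) : M⁻¹ * M = 1 :=
  Matrix.nonsing_inv_mul _ (by simp [h.det])

theorem IsUpperUni.inv {M : Matrix (Fin n) (Fin n) K} (h : IsUpperUni M) : IsUpperUni M⁻¹ := by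
  have : Invertible M := M.invertibleOfIsUnitDet (by simp [h.det])
  have ht : M⁻¹.BlockTriangular id :=
    Matrix.blockTriangular_inv_of_blockTriangular h.blockTriangular
  refine ⟨fun i => ?_, fun i j hij => ht hij⟩
  have := congrFun (congrFun h.mul_inv i) i
  rw [Matrix.mul_apply, Finset.sum_eq_single i] at this
  · simpa [h.1] using this
  · intro m _ hm
    rcases lt_or_gt_of_ne hm with h' | h'
    · simp [h.2 i m h']
    · rw [ht h', mul_zero]
  · simp

theorem isUpperUni_transpose {M : Matrix (Fin n) (Fin n) K} : IsUpperUni Mᵀ ↔ IsLowerUni M :=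
  ⟨fun h => ⟨h.1, fun i j hij => h.2 j i hij⟩, fun h => ⟨h.1, fun i j hij => h.2 j i hij⟩⟩

theorem IsLowerUni.mul {M N : Matrix (Fin n) (Fin n) K} (hM : IsLowerUni M) (hN : IsLowerUni N) :
    IsLowerUni (M * N) := by
  rw [← isUpperUni_transpose] at *
  rw [Matrix.transpose_mul]
  exact hN.mul hM

theorem IsLowerUni.inv {M : Matrix (Fin n) (Fin n) K} (hM : IsLowerUni M) :
    IsLowerUni M⁻¹ := by
  rw [← isUpperUni_transpose] at *
  rw [Matrix.transpose_nonsing_inv]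
  exact hM.inv

theorem IsLowerUni.det {M : Matrix (Fin n) (Fin n) K} (h : IsLowerUni M) : M.det = 1 := by
  rw [← Matrix.det_transpose]
  exact (isUpperUni_transpose.2 h).det

theorem IsLowerUni.mul_inv {M : Matrix (Fin n) (Fin n) K} (h : IsLowerUni M) : M * M⁻¹ = 1 :=
  Matrix.mul_nonsing_inv _ (by simp [h.det])

theorem IsLowerUni.inv_mul {M : Matrix (Fin n) (Fin n) K} (h : IsLowerUni M) : M⁻¹ * M = 1 :=
  Matrix.nonsing_inv_mul _ (by simp [h.det])

theorem mul_apply_mem (S : Subring K) {M N : Matrix (Fin n) (Fin n) K} (hM : ∀ i j, M i j ∈ S)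
    (hN : ∀ i j, N i j ∈ S) (i j : Fin n) : (M * N) i j ∈ S :=
  Matrix.mul_apply (M := M) (N := N) ▸ sum_mem fun m _ => mul_mem (hM i m) (hN m j)

theorem inv_apply_mem (S : Subring K) {M : Matrix (Fin n) (Fin n) K} (hM : ∀ i j, M i j ∈ S)
    (hdet : M.det = 1) (i j : Fin n) : M⁻¹ i j ∈ S := by
  let M' : Matrix (Fin n) (Fin n) S := fun i j => ⟨M i j, hM i j⟩
  have h : M = S.subtype.mapMatrix M' := rfl
  rw [Matrix.inv_def, hdet, Ring.inverse_one, one_smul, h, ← RingHom.map_adjugate]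
  exact (M'.adjugate i j).2

theorem MemNpoly.inv {M : Matrix (Fin n) (Fin n) K} (h : MemNpoly M) : MemNpoly M⁻¹ :=
  ⟨h.1.inv, inv_apply_mem polySubring h.2 h.1.det⟩

theorem MemNpoly.mul {M N : Matrix (Fin n) (Fin n) K} (hM : MemNpoly M) (hN : MemNpoly N) :
    MemNpoly (M * N) :=
  ⟨hM.1.mul hN.1, mul_apply_mem polySubring hM.2 hN.2⟩

theorem memNpoly_transpose {M : Matrix (Fin n) (Fin n) K} : MemNpoly Mᵀ ↔ MemNnegPoly M :=
  and_congr isUpperUni_transpose forall_comm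

theorem MemNnegPoly.inv {M : Matrix (Fin n) (Fin n) K} (h : MemNnegPoly M) : MemNnegPoly M⁻¹ :=
  ⟨h.1.inv, inv_apply_mem polySubring h.2 h.1.det⟩

theorem MemNnegPoly.mul {M N : Matrix (Fin n) (Fin n) K} (hM : MemNnegPoly M)
    (hN : MemNnegPoly N) : MemNnegPoly (M * N) :=
  ⟨hM.1.mul hN.1, mul_apply_mem polySubring hM.2 hN.2⟩

/-- The additive group of matrices with entries in `t^{-m}ℂ[[t⁻¹]]`. -/
def mfilt (n : ℕ) (m : ℤ) : AddSubgroup (Matrix (Fin n) (Fin n) K) where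
  carrier := {M | ∀ i j, M i j ∈ filt m}
  add_mem' hx hy i j := add_mem (hx i j) (hy i j)
  zero_mem' _ _ := zero_mem _
  neg_mem' hx i j := neg_mem (hx i j)

theorem mfilt_mono {a b : ℤ} (h : a ≤ b) {x : Matrix (Fin n) (Fin n) K} (hx : x ∈ mfilt n b) :
    x ∈ mfilt n a :=
  fun i j => filt_mono h (hx i j)

theorem mul_mem_mfilt {a b c : ℤ} {x y : Matrix (Fin n) (Fin n) K} (hx : x ∈ mfilt n a)
    (hy : y ∈ mfilt n b) (h : c ≤ a + b := by norm_num) : x * y ∈ mfilt n c :=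
  fun i j => sum_mem fun m _ => mul_mem_filt' (hx i m) (hy m j) h

theorem one_mem_mfilt : (1 : Matrix (Fin n) (Fin n) K) ∈ mfilt n 0 := by
  intro i j
  rw [Matrix.one_apply]
  split_ifs
  · exact one_mem_filt
  · exact zero_mem _

theorem mem_mfilt_zero_of_sub_one {M : Matrix (Fin n) (Fin n) K} (h : M - 1 ∈ mfilt n 1) :
    M ∈ mfilt n 0 := by
  have := add_mem (mfilt_mono zero_le_one h) one_mem_mfilt
  rwa [sub_add_cancel] at this

theorem mul_sub_one_mem {M N : Matrix (Fin n) (Fin n) K} (hM : M - 1 ∈ mfilt n 1)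
    (hN : N - 1 ∈ mfilt n 1) : M * N - 1 ∈ mfilt n 1 := by
  have : M * N - 1 = M * (N - 1) + (M - 1) := by rw [mul_sub, mul_one, sub_add_sub_cancel]
  rw [this]
  exact add_mem (mul_mem_mfilt (mem_mfilt_zero_of_sub_one hM) hN) hM

theorem memN1_iff {M : Matrix (Fin n) (Fin n) K} :
    MemN1 M ↔ IsUpperUni M ∧ M - 1 ∈ mfilt n 1 := by
  refine and_congr_right fun h => ⟨fun h1 i j => ?_, fun h1 i j hij => ?_⟩
  · rw [Matrix.sub_apply, Matrix.one_apply]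
    split_ifs with hij
    · subst hij
      simp [h.1]
    · rw [sub_zero, ← memO1_iff_mem_filt]
      exact h1 i j hij
  · rw [memO1_iff_mem_filt]
    simpa [Matrix.one_apply, hij] using h1 i j

theorem memN1_transpose {M : Matrix (Fin n) (Fin n) K} : MemN1 Mᵀ ↔ MemN1neg M :=
  and_congr isUpperUni_transpose
    ⟨fun h i j hij => h j i hij.symm, fun h i j hij => h j i hij.symm⟩

theorem memN1neg_iff {M : Matrix (Fin n) (Fin n) K} :
    MemN1neg M ↔ IsLowerUni M ∧ M - 1 ∈ mfilt n 1 := by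
  rw [← memN1_transpose, memN1_iff, isUpperUni_transpose]
  refine and_congr_right fun h => ?_
  rw [← Matrix.transpose_one, ← Matrix.transpose_sub, Matrix.transpose_one]
  exact forall_comm

theorem MemN1.mul {M N : Matrix (Fin n) (Fin n) K} (hM : MemN1 M) (hN : MemN1 N) :
    MemN1 (M * N) := by
  rw [memN1_iff] at *
  exact ⟨hM.1.mul hN.1, mul_sub_one_mem hM.2 hN.2⟩

theorem MemN1neg.mul {M N : Matrix (Fin n) (Fin n) K} (hM : MemN1neg M) (hN : MemN1neg N) :
    MemN1neg (M * N) := by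
  rw [memN1neg_iff] at *
  exact ⟨hM.1.mul hN.1, mul_sub_one_mem hM.2 hN.2⟩

theorem MemN1.inv {M : Matrix (Fin n) (Fin n) K} (hM : MemN1 M) : MemN1 M⁻¹ := by
  rw [memN1_iff] at *
  refine ⟨hM.1.inv, ?_⟩
  have h0 : M⁻¹ ∈ mfilt n 0 :=
    inv_apply_mem intSubring (mem_mfilt_zero_of_sub_one hM.2) hM.1.det
  have : M⁻¹ - 1 = - (M⁻¹ * (M - 1)) := by
    rw [mul_sub, hM.1.inv_mul, mul_one, neg_sub]
  rw [this]
  exact neg_mem (mul_mem_mfilt h0 hM.2)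

theorem MemNpoly.eq_one_of_mul_memN1 {a u u' : Matrix (Fin n) (Fin n) K} (ha : MemNpoly a)
    (hu : MemN1 u) (hu' : MemN1 u') (h : a * u = u') : a = 1 := by
  have h1 : MemN1 a := by
    have : a = u' * u⁻¹ := by rw [← h, mul_assoc, hu.1.mul_inv, mul_one]
    rw [this]
    exact hu'.mul hu.inv
  ext1 i j
  rw [← sub_eq_zero, ← Matrix.sub_apply]
  refine eq_zero_of_mem_poly_of_mem_filt ?_ ((memN1_iff.1 h1).2 i j)
  rw [Matrix.sub_apply, Matrix.one_apply]
  refine sub_mem (ha.2 i j) ?_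
  split_ifs
  · exact one_mem _
  · exact zero_mem _

theorem MemNnegPoly.eq_one_of_mul_memN1neg {b l l' : Matrix (Fin n) (Fin n) K}
    (hb : MemNnegPoly b) (hl : MemN1neg l) (hl' : MemN1neg l') (h : l * b = l') : b = 1 := by
  rw [← memNpoly_transpose] at hb
  rw [← memN1_transpose] at hl hl'
  rw [← Matrix.transpose_eq_one]
  refine hb.eq_one_of_mul_memN1 hl hl' ?_
  rw [← Matrix.transpose_mul, h]

theorem gauss_unique {u u' l l' : Matrix (Fin n) (Fin n) K} {w w' : Fin n → K}
    (hu : IsUpperUni u) (hu' : IsUpperUni u') (hl : IsLowerUni l) (hl' : IsLowerUni l')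
    (hw : ∀ i, w i ≠ 0) (hw' : ∀ i, w' i ≠ 0)
    (h : u * Matrix.diagonal w * l = u' * Matrix.diagonal w' * l') :
    u = u' ∧ w = w' ∧ l = l' := by
  have key : (u'⁻¹ * u) * Matrix.diagonal w = Matrix.diagonal w' * (l' * l⁻¹) := by
    calc (u'⁻¹ * u) * Matrix.diagonal w
        = u'⁻¹ * (u * Matrix.diagonal w * l) * l⁻¹ := by
          simp only [mul_assoc, hl.mul_inv, mul_one]
      _ = (u'⁻¹ * u') * Matrix.diagonal w' * (l' * l⁻¹) := by
          rw [h]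
          simp only [mul_assoc]
      _ = _ := by rw [hu'.inv_mul, one_mul]
  have hW := hu'.inv.mul hu
  have hZ := hl'.mul hl.inv
  have e : ∀ i j, (u'⁻¹ * u) i j * w j = w' i * (l' * l⁻¹) i j := fun i j => by
    have := congrFun (congrFun key i) j
    rwa [Matrix.mul_diagonal, Matrix.diagonal_mul] at this
  have hW1 : u'⁻¹ * u = 1 := by
    ext1 i j
    rcases lt_trichotomy i j with hij | rfl | hij
    · have := e i j
      rw [hZ.2 i j hij, mul_zero, mul_eq_zero, or_iff_left (hw j)] at this
      rw [this, Matrix.one_apply_ne hij.ne]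
    · simp [hW.1]
    · rw [hW.2 i j hij, Matrix.one_apply_ne hij.ne']
  have hZ1 : l' * l⁻¹ = 1 := by
    ext1 i j
    rcases lt_trichotomy i j with hij | rfl | hij
    · rw [hZ.2 i j hij, Matrix.one_apply_ne hij.ne]
    · simp [hZ.1]
    · have := e i j
      rw [hW.2 i j hij, zero_mul, eq_comm, mul_eq_zero, or_iff_right (hw' i)] at this
      rw [this, Matrix.one_apply_ne hij.ne']
  refine ⟨?_, funext fun i => ?_, ?_⟩
  · rw [← one_mul u, ← hu'.mul_inv, mul_assoc, hW1, mul_one]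
  · simpa [hW.1, hZ.1] using e i i
  · rw [← mul_one l', ← hl.inv_mul, ← mul_assoc, hZ1, one_mul]

theorem MemT1.eq_diagonal {h : Matrix (Fin n) (Fin n) K} (hh : MemT1 h) :
    h = Matrix.diagonal fun i => h i i := by
  ext1 i j
  rcases eq_or_ne i j with rfl | hij
  · simp
  · simp [hij, hh.1 i j hij]

theorem MemT1.ne_zero {h : Matrix (Fin n) (Fin n) K} (hh : MemT1 h) (i : Fin n) : h i i ≠ 0 :=
  (inv_sub_one_mem_filt (memO1_iff_mem_filt.1 (hh.2 i))).1

theorem MemT1.mul {h k : Matrix (Fin n) (Fin n) K} (hh : MemT1 h) (hk : MemT1 k) :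
    MemT1 (h * k) := by
  have e : h * k = Matrix.diagonal fun i => h i i * k i i := by
    rw [hh.eq_diagonal, hk.eq_diagonal, Matrix.diagonal_mul_diagonal]
    simp
  rw [e]
  refine ⟨fun i j hij => by simp [hij], fun i => ?_⟩
  have h1 := memO1_iff_mem_filt.1 (hh.2 i)
  have h2 := memO1_iff_mem_filt.1 (hk.2 i)
  rw [memO1_iff_mem_filt, Matrix.diagonal_apply_eq]
  have : h i i * k i i - 1 = (h i i - 1) * (k i i - 1) + (h i i - 1) + (k i i - 1) := by ring
  rw [this]
  exact add_mem (add_mem (mul_mem_filt' h1 h2) h1) h2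

theorem MemT1.mul_tPow {h : Matrix (Fin n) (Fin n) K} (hh : MemT1 h) (ν : Fin n → ℤ) :
    h * tPow ν = Matrix.diagonal fun i => h i i * tK ^ ν i := by
  conv_lhs => rw [hh.eq_diagonal, tPow, Matrix.diagonal_mul_diagonal]

theorem MemT1.mul_tPow_ne_zero {h : Matrix (Fin n) (Fin n) K} (hh : MemT1 h) (ν : Fin n → ℤ)
    (i : Fin n) : h i i * tK ^ ν i ≠ 0 :=
  mul_ne_zero (hh.ne_zero i) (zpow_ne_zero _ tK_ne_zero)

theorem IsGauss.unique {ν : Fin n → ℤ} {y u h l u' h' l' : Matrix (Fin n) (Fin n) K}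
    (H : IsGauss ν y u h l) (H' : IsGauss ν y u' h' l') : u = u' := by
  obtain ⟨hu, hh, hl, e⟩ := H
  obtain ⟨hu', hh', hl', e'⟩ := H'
  rw [e, mul_assoc u, mul_assoc u', hh.mul_tPow, hh'.mul_tPow] at e'
  exact (gauss_unique hu.1 hu'.1 hl.1 hl'.1 (hh.mul_tPow_ne_zero ν) (hh'.mul_tPow_ne_zero ν) e').1

theorem IsGauss.gaussUF_eq {ν : Fin n → ℤ} {y u h l : Matrix (Fin n) (Fin n) K}
    (H : IsGauss ν y u h l) : gaussUF ν y = u := by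
  have hex : ∃ u, ∃ hh l, IsGauss ν y u hh l := ⟨u, h, l, H⟩
  rw [gaussUF, dif_pos hex]
  obtain ⟨h', l', H'⟩ := hex.choose_spec
  exact H'.unique H

theorem IsPiOf.unique {ν : Fin n → ℤ} {x z z' : Matrix (Fin n) (Fin n) K}
    (H : IsPiOf ν x z) (H' : IsPiOf ν x z') : z = z' := by
  obtain ⟨⟨u, h, l, hu, hh, hl, e⟩, a, b, ha, hb, hz⟩ := H
  obtain ⟨⟨u', h', l', hu', hh', hl', e'⟩, a', b', ha', hb', hz'⟩ := H'
  have hx : x = a⁻¹ * z * b⁻¹ := by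
    rw [hz, mul_assoc a x b, ← mul_assoc a⁻¹, ha.1.inv_mul, one_mul, mul_assoc, hb.1.mul_inv,
      mul_one]
  set A := a' * a⁻¹ with hA
  set B := b⁻¹ * b' with hB
  have hAp : MemNpoly A := ha'.mul ha.inv
  have hBp : MemNnegPoly B := hb.inv.mul hb'
  have hzz : z' = A * z * B := by
    rw [hz', hx, hA, hB]
    simp only [mul_assoc]
  have key : (A * u) * Matrix.diagonal (fun i => h i i * tK ^ ν i) * (l * B) =
      u' * Matrix.diagonal (fun i => h' i i * tK ^ ν i) * l' := by
    rw [← hh.mul_tPow, ← hh'.mul_tPow, ← mul_assoc u', ← e', hzz, e]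
    simp only [mul_assoc]
  obtain ⟨h1, -, h3⟩ := gauss_unique (hAp.1.mul hu.1) hu'.1 (hl.1.mul hBp.1) hl'.1
    (hh.mul_tPow_ne_zero ν) (hh'.mul_tPow_ne_zero ν) key
  rw [hzz, hAp.eq_one_of_mul_memN1 hu hu' h1, hBp.eq_one_of_mul_memN1neg hl hl' h3, one_mul,
    mul_one]

theorem IsPiOf.piF_eq {ν : Fin n → ℤ} {x z : Matrix (Fin n) (Fin n) K}
    (H : IsPiOf ν x z) : piF ν x = z := by
  have hex : ∃ z, IsPiOf ν x z := ⟨z, H⟩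
  rw [piF, dif_pos hex]
  exact hex.choose_spec.unique H

/-- Birkhoff-type factorization `N₋(K) = N₋,₁[[t⁻¹]] · N₋[t]`. -/
theorem IsLowerUni.exists_mul_memN1neg {L : Matrix (Fin n) (Fin n) K} (hL : IsLowerUni L) :
    ∃ B, MemNnegPoly B ∧ MemN1neg (L * B) := by
  have col : ∀ (j : Fin n) (m : ℕ), ∃ v : Fin n → K, v j = 1 ∧ (∀ i < j, v i = 0) ∧
      (∀ i, v i ∈ polySubring) ∧ ∀ i : Fin n, (i : ℕ) < m → j < i → (L *ᵥ v) i ∈ filt 1 := by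
    intro j m
    induction m with
    | zero =>
      refine ⟨Pi.single j 1, by simp, fun i hi => by simp [hi.ne], fun i => ?_, by simp⟩
      rcases eq_or_ne i j with rfl | hij
      · simp
      · simp [hij]
    | succ m ih =>
      obtain ⟨v, hv1, hv2, hv3, hv4⟩ := ih
      by_cases hm : m < n ∧ (j : ℕ) < m
      · obtain ⟨p, hp, hp'⟩ := exists_poly_sub_mem_filt ((L *ᵥ v) ⟨m, hm.1⟩)
        have hj : j < ⟨m, hm.1⟩ := hm.2
        refine ⟨v - Pi.single ⟨m, hm.1⟩ p, ?_, ?_, ?_, ?_⟩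
        · simp [hv1, hj.ne]
        · intro i hi
          simp [hv2 i hi, (hi.trans hj).ne]
        · intro i
          rw [Pi.sub_apply]
          refine sub_mem (hv3 i) ?_
          rcases eq_or_ne i ⟨m, hm.1⟩ with rfl | him
          · simpa using hp
          · simp [him]
        · intro i hi hji
          rw [Matrix.mulVec_sub, Pi.sub_apply, Matrix.mulVec_single]
          rcases eq_or_ne i ⟨m, hm.1⟩ with rfl | him
          · simpa [hL.1] using hp'
          · have hlt : (i : ℕ) < m := by
              have : (i : ℕ) ≠ m := fun h => him (Fin.ext h)
              omega
            have := hL.2 i ⟨m, hm.1⟩ hlt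
            simpa [this] using hv4 i hlt hji
      · refine ⟨v, hv1, hv2, hv3, fun i hi hji => hv4 i ?_ hji⟩
        have := i.isLt
        have : (j : ℕ) < i := hji
        omega
  choose v h1 h2 h3 h4 using fun j => col j n
  have hB : IsLowerUni (Matrix.of fun i j => v j i) := ⟨h1, fun i j hij => h2 j i hij⟩
  refine ⟨Matrix.of fun i j => v j i, ⟨hB, fun i j => h3 j i⟩, hL.mul hB, fun i j hij => ?_⟩
  rcases lt_or_gt_of_ne hij with h | h
  · rw [(hL.mul hB).2 i j h]
    exact fun _ _ => rfl
  · rw [memO1_iff_mem_filt]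
    exact h4 j i i.isLt h

end Unitriangular

section Factorization

variable {n : ℕ}

theorem MemN1neg.inv {M : Matrix (Fin n) (Fin n) K} (hM : MemN1neg M) : MemN1neg M⁻¹ := by
  rw [← memN1_transpose] at *
  rw [Matrix.transpose_nonsing_inv]
  exact hM.inv

theorem isUpperUni_one_add_vecMulVec {x y : Fin n → K} (h : ∀ i j, j ≤ i → x i * y j = 0) :
    IsUpperUni (1 + Matrix.vecMulVec x y) :=
  ⟨fun i => by simp [Matrix.vecMulVec_apply, h i i le_rfl],
    fun i j hij => by simp [Matrix.vecMulVec_apply, h i j hij.le, hij.ne']⟩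

theorem isLowerUni_one_add_vecMulVec {x y : Fin n → K} (h : ∀ i j, i ≤ j → x i * y j = 0) :
    IsLowerUni (1 + Matrix.vecMulVec x y) :=
  ⟨fun i => by simp [Matrix.vecMulVec_apply, h i i le_rfl],
    fun i j hij => by simp [Matrix.vecMulVec_apply, h i j hij.le, hij.ne]⟩

theorem one_add_vecMulVec_mul_apply (x y : Fin n → K) (M : Matrix (Fin n) (Fin n) K)
    (i j : Fin n) : ((1 + Matrix.vecMulVec x y) * M) i j = M i j + x i * ∑ m, y m * M m j := by
  rw [add_mul, one_mul, Matrix.vecMulVec_mul, Matrix.add_apply, Matrix.vecMulVec_apply]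
  rfl

theorem mul_one_add_vecMulVec_apply (x y : Fin n → K) (M : Matrix (Fin n) (Fin n) K)
    (i j : Fin n) : (M * (1 + Matrix.vecMulVec x y)) i j = M i j + (∑ m, M i m * x m) * y j := by
  rw [mul_add, mul_one, Matrix.mul_vecMulVec, Matrix.add_apply, Matrix.vecMulVec_apply]
  rfl

/-- The congruence subgroup equals `N₁[[t⁻¹]] · T₁[[t⁻¹]] · N₋,₁[[t⁻¹]]`. -/
theorem exists_gauss_of_sub_one_mem {γ : Matrix (Fin n) (Fin n) K} (hγ : γ - 1 ∈ mfilt n 1) :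
    ∃ u d l, MemN1 u ∧ MemT1 d ∧ MemN1neg l ∧ γ = u * d * l := by
  have step : ∀ m : ℕ, ∃ U L, MemN1 U ∧ MemN1neg L ∧ U * γ * L - 1 ∈ mfilt n 1 ∧
      ∀ i j : Fin n, i ≠ j → (n ≤ i + m ∨ n ≤ j + m) → (U * γ * L) i j = 0 := by
    intro m
    induction m with
    | zero =>
      refine ⟨1, 1, memN1_iff.2 ⟨⟨by simp, fun i j h => by simp [h.ne']⟩, by simp⟩,
        memN1neg_iff.2 ⟨⟨by simp, fun i j h => by simp [h.ne]⟩, by simp⟩, by simpa using hγ,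
        fun i j _ h => ?_⟩
      have := i.isLt
      have := j.isLt
      omega
    | succ m ih =>
      obtain ⟨U, L, hU, hL, hg, h0⟩ := ih
      by_cases hm : n ≤ m
      · exact ⟨U, L, hU, hL, hg, fun i j hij _ => h0 i j hij (by omega)⟩
      set g := U * γ * L with hgdef
      let q : Fin n := ⟨n - (m + 1), by omega⟩
      have hqv : (q : ℕ) = n - (m + 1) := rfl
      obtain ⟨hq0, hq⟩ : g q q ≠ 0 ∧ (g q q)⁻¹ - 1 ∈ filt 1 :=
        inv_sub_one_mem_filt (by simpa using hg q q)
      have hqi : (g q q)⁻¹ ∈ filt 0 := by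
        simpa using add_mem (filt_mono zero_le_one hq) one_mem_filt
      have hoff : ∀ i j, i ≠ j → g i j ∈ filt 1 := fun i j hij => by
        simpa [Matrix.one_apply, hij] using hg i j
      let x : Fin n → K := fun i => if i < q then - g i q * (g q q)⁻¹ else 0
      let y : Fin n → K := fun j => if j < q then - g q j * (g q q)⁻¹ else 0
      have hx1 : ∀ i, x i ∈ filt 1 := fun i => by
        simp only [x]
        split_ifs with h
        · exact mul_mem_filt' (neg_mem (hoff i q h.ne)) hqi
        · exact zero_mem _
      have hy1 : ∀ i, y i ∈ filt 1 := fun i => by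
        simp only [y]
        split_ifs with h
        · exact mul_mem_filt' (neg_mem (hoff q i h.ne')) hqi
        · exact zero_mem _
      let e : Fin n → K := Pi.single q 1
      have he : ∀ i, e i ∈ filt 0 := fun i => by
        rcases eq_or_ne i q with rfl | h
        · simpa [e] using one_mem_filt
        · simp [e, h]
      have hX : MemN1 (1 + Matrix.vecMulVec x e) := by
        refine memN1_iff.2 ⟨isUpperUni_one_add_vecMulVec fun i j hij => ?_, fun i j => ?_⟩
        · rcases eq_or_ne j q with rfl | h
          · simp [x, hij.not_gt]
          · simp [e, h]
        · rw [add_sub_cancel_left, Matrix.vecMulVec_apply]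
          exact mul_mem_filt' (hx1 i) (he j)
      have hY : MemN1neg (1 + Matrix.vecMulVec e y) := by
        refine memN1neg_iff.2 ⟨isLowerUni_one_add_vecMulVec fun i j hij => ?_, fun i j => ?_⟩
        · rcases eq_or_ne i q with rfl | h
          · simp [y, hij.not_gt]
          · simp [e, h]
        · rw [add_sub_cancel_left, Matrix.vecMulVec_apply]
          exact mul_mem_filt' (he i) (hy1 j)
      have hnew : (1 + Matrix.vecMulVec x e) * U * γ * (L * (1 + Matrix.vecMulVec e y)) =
          (1 + Matrix.vecMulVec x e) * g * (1 + Matrix.vecMulVec e y) := by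
        rw [hgdef]
        simp only [mul_assoc]
      refine ⟨(1 + Matrix.vecMulVec x e) * U, L * (1 + Matrix.vecMulVec e y), hX.mul hU,
        hL.mul hY, ?_, ?_⟩
      · rw [hnew]
        exact mul_sub_one_mem (mul_sub_one_mem (memN1_iff.1 hX).2 hg) (memN1neg_iff.1 hY).2
      · intro i j hij hor
        rw [hnew, mul_one_add_vecMulVec_apply]
        simp only [one_add_vecMulVec_mul_apply, e, Pi.single_apply, ite_mul, one_mul, zero_mul,
          mul_ite, mul_one, mul_zero, Finset.sum_ite_eq', Finset.mem_univ,
          if_true]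
        have cx : ∀ i, i < q → g i q + x i * g q q = 0 := fun i hi => by
          simp [x, hi, hq0]
        have cy : ∀ j, j < q → g q j + g q q * y j = 0 := fun j hj => by
          simp only [y, hj, if_true]
          field_simp
          ring
        have x0 : ∀ i, ¬ i < q → x i = 0 := fun i hi => by simp [x, hi]
        have y0 : ∀ j, ¬ j < q → y j = 0 := fun i hi => by simp [y, hi]
        have z : ∀ i j, i ≠ j → (q < i ∨ q < j) → g i j = 0 := fun i j hij h => by
          refine h0 i j hij ?_
          rw [Fin.lt_def, Fin.lt_def] at h
          omega
        rcases lt_trichotomy i q with hi | rfl | hi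
        · have hj : ¬ j < q := by
            rw [Fin.lt_def] at hi ⊢
            omega
          rw [y0 j hj, mul_zero, add_zero]
          rcases eq_or_ne j q with rfl | hjq
          · exact cx i hi
          · have hj' : q < j := lt_of_le_of_ne (not_lt.1 hj) hjq.symm
            rw [z i j hij (Or.inr hj'), z q j hj'.ne (Or.inr hj'), mul_zero, add_zero]
        · rw [x0 q (lt_irrefl q)]
          simp only [zero_mul, add_zero]
          rcases lt_or_gt_of_ne hij with hj | hj
          · rw [z q j hij (Or.inr hj), y0 j hj.not_gt, mul_zero, add_zero]
          · exact cy j hj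
        · rw [x0 i hi.not_gt, z i j hij (Or.inl hi), z i q hi.ne' (Or.inl hi)]
          simp
  obtain ⟨U, L, hU, hL, hg, h0⟩ := step n
  refine ⟨U⁻¹, U * γ * L, L⁻¹, hU.inv, ⟨fun i j hij => h0 i j hij (by omega), fun i => ?_⟩,
    hL.inv, ?_⟩
  · rw [memO1_iff_mem_filt]
    simpa using hg i i
  · rw [← mul_assoc, ← mul_assoc, hU.1.inv_mul, one_mul, mul_assoc, hL.1.mul_inv, mul_one]

theorem IsLowerUni.exists_mul_diagonal {X : Matrix (Fin n) (Fin n) K} (hX : IsLowerUni X)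
    {w : Fin n → K} (hw : ∀ i, w i ≠ 0) :
    ∃ X', IsLowerUni X' ∧ X * Matrix.diagonal w = Matrix.diagonal w * X' := by
  refine ⟨Matrix.of fun i j => (w i)⁻¹ * (X i j * w j), ⟨fun i => ?_, fun i j hij => ?_⟩, ?_⟩
  · simp [hX.1, hw]
  · simp [hX.2 i j hij]
  · ext1 i j
    simp [hw]

/-- If `V·A·u·L·t^{-β}·M` lies in the congruence subgroup, where `u` is the upper factor of
`y ∈ Gr_ν`, then `π(A·y)` exists in `Gr_{ν+β}`, and its upper factor is that of the former. -/
theorem IsGauss.exists_pi {ν β : Fin n → ℤ} {A y u h l V L M : Matrix (Fin n) (Fin n) K}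
    (H : IsGauss ν y u h l) (hL : IsLowerUni L) (hM : IsLowerUni M)
    (hγ : V * (A * u) * L * tPow (-β) * M - 1 ∈ mfilt n 1) :
    ∃ z u' h' l' B d m, IsGauss (ν + β) z u' h' l' ∧ MemNnegPoly B ∧ z = V * (A * y) * B ∧
      MemT1 d ∧ MemN1neg m ∧ V * (A * u) * L * tPow (-β) * M = u' * d * m := by
  obtain ⟨u', d, m, hu', hd, hm, e⟩ := exists_gauss_of_sub_one_mem hγ
  obtain ⟨hu, hh, hl, rfl⟩ := H
  obtain ⟨L', hL', eL⟩ := hL.inv.exists_mul_diagonal (hh.mul_tPow_ne_zero ν)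
  obtain ⟨M', hM', eM⟩ := (hm.1.mul hM.inv).exists_mul_diagonal (hh.mul_tPow_ne_zero (ν + β))
  rw [← hh.mul_tPow] at eL eM
  have hW : IsLowerUni (M' * (L' * l)) := hM'.mul (hL'.mul hl.1)
  obtain ⟨B, hB, hB1⟩ := hW.exists_mul_memN1neg
  have ht : tPow (-β) * tPow β = (1 : Matrix (Fin n) (Fin n) K) := by
    rw [tPow, tPow, Matrix.diagonal_mul_diagonal, ← Matrix.diagonal_one]
    congr 1
    ext1 i
    rw [Pi.neg_apply, ← zpow_add₀ tK_ne_zero, neg_add_cancel, zpow_zero]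
  have hcomm : tPow β * (h * tPow ν) = h * tPow (ν + β) := by
    rw [hh.mul_tPow, hh.mul_tPow, tPow, Matrix.diagonal_mul_diagonal]
    congr 1
    ext1 i
    rw [Pi.add_apply, zpow_add₀ tK_ne_zero]
    ring
  have key : V * (A * u) = u' * d * (m * M⁻¹) * tPow β * L⁻¹ := by
    rw [← mul_assoc (u' * d), ← e]
    simp only [mul_assoc]
    rw [← mul_assoc M, hM.mul_inv, one_mul, ← mul_assoc (tPow (-β)), ht, one_mul, hL.mul_inv,
      mul_one]
  refine ⟨V * (A * (u * h * tPow ν * l)) * B, u', d * h, M' * (L' * l) * B, B, d, m,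
    ⟨hu', hd.mul hh, hB1, ?_⟩, hB, rfl, hd, hm, e⟩
  calc V * (A * (u * h * tPow ν * l)) * B
      = (V * (A * u)) * (h * tPow ν) * l * B := by simp only [mul_assoc]
    _ = u' * d * (m * M⁻¹) * tPow β * (L⁻¹ * (h * tPow ν)) * l * B := by
      rw [key]
      simp only [mul_assoc]
    _ = u' * d * ((m * M⁻¹) * (tPow β * (h * tPow ν))) * L' * l * B := by
      rw [eL]
      simp only [mul_assoc]
    _ = _ := by
      rw [hcomm, eM]
      simp only [mul_assoc]

/-- Above the diagonal, `u` agrees with `γ = u·d·l` to first order. -/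
theorem upper_sub_mem_filt {γ u d l : Matrix (Fin n) (Fin n) K} (hu : MemN1 u) (hd : MemT1 d)
    (hl : MemN1neg l) (h : γ = u * d * l) {i j : Fin n} (hij : i < j) :
    u i j - γ i j ∈ filt 2 := by
  have hu' := (memN1_iff.1 hu).2
  have hl' := (memN1neg_iff.1 hl).2
  have hd' : d - 1 ∈ mfilt n 1 := fun i j => by
    rw [Matrix.sub_apply, Matrix.one_apply]
    split_ifs with hij
    · subst hij
      exact memO1_iff_mem_filt.1 (hd.2 i)
    · rw [hd.1 i j hij, sub_zero]
      exact zero_mem _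
  have key : γ - (u + d + l - 1 - 1) =
      (u - 1) * (d - 1) * l + (u - 1) * (l - 1) + (d - 1) * (l - 1) := by
    rw [h]
    simp only [mul_sub, sub_mul, one_mul, mul_one]
    abel
  have hmem : γ - (u + d + l - 1 - 1) ∈ mfilt n 2 := by
    rw [key]
    exact add_mem (add_mem (mul_mem_mfilt (a := 2) (mul_mem_mfilt hu' hd')
      (mem_mfilt_zero_of_sub_one hl')) (mul_mem_mfilt hu' hl')) (mul_mem_mfilt hd' hl')
  have := neg_mem (hmem i j)
  simpa [hd.1 i j hij.ne, hl.1.2 i j hij, hij.ne] using this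

/-- The upper factor to second order, in a column vanishing to first order below the diagonal. -/
theorem upper_mul_sub_mem_filt {γ u d l : Matrix (Fin n) (Fin n) K} (hu : MemN1 u) (hd : MemT1 d)
    (hl : MemN1neg l) (h : γ = u * d * l) {i j : Fin n} (hij : i < j)
    (h0 : ∀ m, j < m → γ m j ∈ filt 2) :
    u i j * γ j j - γ i j ∈ filt 3 := by
  have e : ∀ i j, γ i j = ∑ m, u i m * (d m m * l m j) := fun i j => by
    rw [h, mul_assoc, Matrix.mul_apply]
    refine Finset.sum_congr rfl fun m _ => ?_
    rw [hd.eq_diagonal, Matrix.diagonal_mul]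
    simp
  have hu' : ∀ i j, i ≠ j → u i j ∈ filt 1 := fun i j hij => memO1_iff_mem_filt.1 (hu.2 i j hij)
  have hd' : ∀ i, d i i ∈ filt 0 := fun i => by
    simpa using add_mem (filt_mono zero_le_one (memO1_iff_mem_filt.1 (hd.2 i))) one_mem_filt
  have hl1 : ∀ i j, i ≠ j → l i j ∈ filt 1 := fun i j hij => memO1_iff_mem_filt.1 (hl.2 i j hij)
  have hl2 : ∀ m, j < m → d m m * l m j ∈ filt 2 := fun m hm => by
    have h1 := e m j
    rw [← Finset.add_sum_erase _ _ (Finset.mem_univ m), hu.1.1, one_mul] at h1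
    rw [← sub_eq_iff_eq_add.2 h1]
    refine sub_mem (h0 m hm) (sum_mem fun p hp => ?_)
    have hpm := (Finset.mem_erase.1 hp).1
    rcases lt_or_gt_of_ne hpm with hlt | hlt
    · rw [hu.1.2 m p hlt, zero_mul]
      exact zero_mem _
    · exact mul_mem_filt' (hu' m p hpm.symm)
        (mul_mem_filt' (c := 1) (hd' p) (hl1 p j (hm.trans hlt).ne'))
  have tail : ∀ i ≤ j, γ i j - u i j * d j j ∈ filt 3 := fun i hij => by
    rw [e, ← Finset.add_sum_erase _ _ (Finset.mem_univ j), hl.1.1, mul_one, add_sub_cancel_left]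
    refine sum_mem fun p hp => ?_
    rcases lt_or_gt_of_ne (Finset.mem_erase.1 hp).1 with hlt | hlt
    · rw [hl.1.2 p j hlt, mul_zero, mul_zero]
      exact zero_mem _
    · exact mul_mem_filt' (hu' i p (hij.trans_lt hlt).ne) (hl2 p hlt)
  have h1 := tail j le_rfl
  rw [hu.1.1, one_mul] at h1
  have h2 : u i j * γ j j - γ i j = u i j * (γ j j - d j j) - (γ i j - u i j * d j j) := by ring
  rw [h2]
  exact sub_mem (mul_mem_filt' (hu' i j hij.ne) h1) (tail i hij.le)

end Factorization

section Slice

variable {n : ℕ}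

/-- The matrix `τ_α(y(p,e,b,g))` with `c = p + ∑ bᵢgᵢ`, where `b` and `g` are extended by zero. -/
def sliceMat (f l : Fin n) (c e : ℂ) (b g : Fin n → ℂ) : Matrix (Fin n) (Fin n) K :=
  fun i =>
    if i = f then Pi.single l (Cc e)
    else if i = l then
      (Pi.single l (tK - Cc c) - Pi.single f (Cc e⁻¹) - fun j => Cc (g j) : Fin n → K)
    else Pi.single i 1 + Pi.single l (Cc (b i))

/-- The inverse of `sliceMat`. -/
def sliceInv (f l : Fin n) (c e : ℂ) (b g : Fin n → ℂ) : Matrix (Fin n) (Fin n) K :=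
  fun i =>
    if i = f then
      (Pi.single f (tK - Cc (c - ∑ m, b m * g m)) - Pi.single l (Cc e) -
        fun j => Cc e * Cc (g j) : Fin n → K)
    else if i = l then Pi.single f (Cc e⁻¹)
    else Pi.single i 1 - Pi.single f (Cc (b i * e⁻¹))

variable {f l : Fin n} {c e : ℂ} {b g : Fin n → ℂ} {i : Fin n}

theorem sliceMat_first_dotProduct (v : Fin n → K) :
    sliceMat f l c e b g f ⬝ᵥ v = Cc e * v l := by
  simp [sliceMat]

theorem sliceMat_last_dotProduct (hfl : f < l) (v : Fin n → K) :
    sliceMat f l c e b g l ⬝ᵥ v =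
      (tK - Cc c) * v l - Cc e⁻¹ * v f - ∑ m, Cc (g m) * v m := by
  simp only [sliceMat, if_neg hfl.ne', if_true, sub_dotProduct, single_dotProduct]
  rfl

theorem sliceMat_mid_dotProduct (h1 : i ≠ f) (h2 : i ≠ l) (v : Fin n → K) :
    sliceMat f l c e b g i ⬝ᵥ v = v i + Cc (b i) * v l := by
  simp [sliceMat, h1, h2, add_dotProduct]

theorem sliceInv_first_dotProduct (v : Fin n → K) :
    sliceInv f l c e b g f ⬝ᵥ v =
      (tK - Cc (c - ∑ m, b m * g m)) * v f - Cc e * v l - Cc e * ∑ m, Cc (g m) * v m := by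
  simp only [sliceInv, if_true, sub_dotProduct, single_dotProduct,
    Finset.mul_sum, ← mul_assoc]
  rfl

theorem sliceInv_last_dotProduct (hfl : f < l) (v : Fin n → K) :
    sliceInv f l c e b g l ⬝ᵥ v = Cc e⁻¹ * v f := by
  simp [sliceInv, hfl.ne']

theorem sliceInv_mid_dotProduct (h1 : i ≠ f) (h2 : i ≠ l) (v : Fin n → K) :
    sliceInv f l c e b g i ⬝ᵥ v = v i - Cc (b i * e⁻¹) * v f := by
  simp [sliceInv, h1, h2, sub_dotProduct]

theorem Cc_mul (x y : ℂ) : Cc (x * y) = Cc x * Cc y := map_mul _ _ _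

theorem Cc_sub (x y : ℂ) : Cc (x - y) = Cc x - Cc y := map_sub _ _ _

theorem Cc_zero : Cc 0 = 0 := map_zero _

theorem Cc_one : Cc 1 = 1 := map_one _

theorem Cc_neg (x : ℂ) : Cc (-x) = - Cc x := map_neg _ _

theorem Cc_sum {ι : Type*} (s : Finset ι) (x : ι → ℂ) : Cc (∑ i ∈ s, x i) = ∑ i ∈ s, Cc (x i) :=
  map_sum _ _ _

theorem Cc_mul_Cc_inv {e : ℂ} (he : e ≠ 0) : Cc e * Cc e⁻¹ = 1 := by
  rw [← Cc_mul, mul_inv_cancel₀ he, Cc_one]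

theorem sliceMat_mul_sliceInv (hfl : f < l) (he : e ≠ 0)
    (hb : ∀ i, ¬ (f < i ∧ i < l) → b i = 0) (hg : ∀ i, ¬ (f < i ∧ i < l) → g i = 0) :
    sliceMat f l c e b g * sliceInv f l c e b g = 1 := by
  have hee := Cc_mul_Cc_inv he
  have eI : ∀ i j, sliceInv f l c e b g i j = sliceInv f l c e b g i ⬝ᵥ Pi.single j 1 := by simp
  ext1 i j
  rw [Matrix.mul_apply']
  rcases eq_or_ne i f with rfl | h1
  · rw [sliceMat_first_dotProduct, eI, sliceInv_last_dotProduct hfl, ← mul_assoc, hee, one_mul,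
      Matrix.one_apply, Pi.single_apply]
  rcases eq_or_ne i l with rfl | h2
  · have hs : ∑ m, Cc (g m) * sliceInv f i c e b g m j =
        ∑ m, Cc (g m) * (Pi.single j 1 : Fin n → K) m -
          Cc (∑ m, b m * g m) * Cc e⁻¹ * (Pi.single j 1 : Fin n → K) f := by
      rw [Cc_sum, Finset.sum_mul, Finset.sum_mul, ← Finset.sum_sub_distrib]
      refine Finset.sum_congr rfl fun m _ => ?_
      by_cases hm : f < m ∧ m < i
      · rw [eI, sliceInv_mid_dotProduct hm.1.ne' hm.2.ne, Cc_mul, Cc_mul]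
        ring
      · simp [hg m hm, Cc_zero]
    rw [sliceMat_last_dotProduct hfl, hs, eI, eI, sliceInv_first_dotProduct,
      sliceInv_last_dotProduct hfl, Cc_sub, Matrix.one_apply,
      ← Pi.single_apply j (1 : K) i]
    linear_combination ((∑ m, Cc (g m) * (Pi.single j 1 : Fin n → K) m) +
      (Pi.single j 1 : Fin n → K) i) * hee
  · rw [sliceMat_mid_dotProduct h1 h2, eI, eI, sliceInv_last_dotProduct hfl,
      sliceInv_mid_dotProduct h1 h2, Cc_mul, Matrix.one_apply, Pi.single_apply]
    ring

theorem sliceInv_mul_sliceMat (hfl : f < l) (he : e ≠ 0)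
    (hb : ∀ i, ¬ (f < i ∧ i < l) → b i = 0) (hg : ∀ i, ¬ (f < i ∧ i < l) → g i = 0) :
    sliceInv f l c e b g * sliceMat f l c e b g = 1 :=
  mul_eq_one_comm.1 (sliceMat_mul_sliceInv hfl he hb hg)

theorem single_apply_mem (S : Subring K) (i j : Fin n) {x : K} (hx : x ∈ S) :
    (Pi.single i x : Fin n → K) j ∈ S := by
  rw [Pi.single_apply]
  split_ifs
  · exact hx
  · exact zero_mem _

theorem sliceMat_apply_mem (i j : Fin n) : sliceMat f l c e b g i j ∈ polySubring := by
  rw [sliceMat]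
  split_ifs
  · exact single_apply_mem _ _ _ (Cc_mem_poly _)
  · exact sub_mem (sub_mem (single_apply_mem _ _ _ (sub_mem tK_mem_poly (Cc_mem_poly _)))
      (single_apply_mem _ _ _ (Cc_mem_poly _))) (Cc_mem_poly _)
  · exact add_mem (single_apply_mem _ _ _ (one_mem _)) (single_apply_mem _ _ _ (Cc_mem_poly _))

theorem sliceInv_apply_mem (i j : Fin n) : sliceInv f l c e b g i j ∈ polySubring := by
  rw [sliceInv]
  split_ifs
  · exact sub_mem (sub_mem (single_apply_mem _ _ _ (sub_mem tK_mem_poly (Cc_mem_poly _)))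
      (single_apply_mem _ _ _ (Cc_mem_poly _))) (mul_mem (Cc_mem_poly _) (Cc_mem_poly _))
  · exact single_apply_mem _ _ _ (Cc_mem_poly _)
  · exact sub_mem (single_apply_mem _ _ _ (one_mem _)) (single_apply_mem _ _ _ (Cc_mem_poly _))

theorem one_add_mul_one_add {x y x' y' : Fin n → K} (h : y ⬝ᵥ x' = 0) :
    (1 + Matrix.vecMulVec x y) * (1 + Matrix.vecMulVec x' y') =
      1 + Matrix.vecMulVec x y + Matrix.vecMulVec x' y' := by
  have h0 : Matrix.vecMulVec x y * Matrix.vecMulVec x' y' = 0 := by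
    ext1 i j
    rw [Matrix.vecMulVec_mul_vecMulVec, h, Matrix.vecMulVec_apply]
    simp
  rw [add_mul, mul_add, mul_add, h0]
  simp only [one_mul, mul_one]
  abel

theorem one_add_neg_mul_one_add {x y : Fin n → K} (h : y ⬝ᵥ x = 0) :
    (1 + Matrix.vecMulVec (-x) y) * (1 + Matrix.vecMulVec x y) = 1 := by
  rw [one_add_mul_one_add h]
  ext1 i j
  rw [Matrix.add_apply, Matrix.add_apply, Matrix.vecMulVec_apply, Matrix.vecMulVec_apply,
    Pi.neg_apply]
  ring

theorem conj_one_add_vecMulVec {A A' : Matrix (Fin n) (Fin n) K} (h : A' * A = 1)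
    (x y : Fin n → K) :
    A' * (1 + Matrix.vecMulVec x y) * A = 1 + Matrix.vecMulVec (A' *ᵥ x) (y ᵥ* A) := by
  rw [mul_add, add_mul, mul_one, h, Matrix.mul_vecMulVec, Matrix.vecMulVec_mul]

end Slice

section Multiplication

variable {n : ℕ} {f l : Fin n} {c e : ℂ} {b g : Fin n → ℂ} {u : Matrix (Fin n) (Fin n) K}

/-- The coweight with entry `1` at `f` and `-1` at `l`. -/
def rootCoweight (f l : Fin n) : Fin n → ℤ := fun i => if i = f then 1 else if i = l then -1 else 0

theorem coeff_eq_of_sub_mem_filt {m j : ℤ} {x y : K} (h : x - y ∈ filt m) (hj : j < m) :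
    x.coeff j = y.coeff j := by
  have := h j hj
  rwa [HahnSeries.coeff_sub, sub_eq_zero] at this

theorem coeff_Cc_mul_tK_inv_one (z : ℂ) : (Cc z * tK⁻¹).coeff 1 = z := by
  rw [coeff_Cc_mul, tK_inv, HahnSeries.coeff_single_same, mul_one]

theorem coeff_Cc_mul_tK_inv_two (z : ℂ) : (Cc z * tK⁻¹).coeff 2 = 0 := by
  rw [coeff_Cc_mul, tK_inv, HahnSeries.coeff_single_of_ne (by norm_num), mul_zero]

theorem sub_Cc_mul_tK_inv_mem_filt {x : K} (hx : x ∈ filt 1) :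
    x - Cc (x.coeff 1) * tK⁻¹ ∈ filt 2 := by
  have := mul_mem_filt (tK_mul_sub_Cc_mem_filt hx) tK_inv_mem_filt
  rwa [sub_mul, mul_right_comm, mul_inv_cancel₀ tK_ne_zero, one_mul] at this

theorem MemN1.mem_filt_one (hu : MemN1 u) {i j : Fin n} (hij : i ≠ j) : u i j ∈ filt 1 :=
  memO1_iff_mem_filt.1 (hu.2 i j hij)

theorem MemN1.mem_filt_zero (hu : MemN1 u) (i j : Fin n) : u i j ∈ filt 0 :=
  mem_mfilt_zero_of_sub_one (memN1_iff.1 hu).2 i j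

theorem sum_Cc_mul_sub_mem_filt (hu : MemN1 u) (g : Fin n → ℂ) (j : Fin n) :
    ∑ m, Cc (g m) * u m j - Cc (g j) ∈ filt 1 := by
  have : Cc (g j) = ∑ m, Cc (g m) * (1 : Matrix (Fin n) (Fin n) K) m j := by
    simp [Matrix.one_apply]
  rw [this, ← Finset.sum_sub_distrib]
  refine sum_mem fun m _ => ?_
  rw [← mul_sub]
  exact mul_mem_filt' (Cc_mem_filt _) ((memN1_iff.1 hu).2 m j)

theorem sum_Cc_mul_mem_filt (hu : MemN1 u) (g : Fin n → ℂ) (j : Fin n) :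
    ∑ m, Cc (g m) * u m j ∈ filt 0 := by
  simpa using add_mem (filt_mono zero_le_one (sum_Cc_mul_sub_mem_filt hu g j)) (Cc_mem_filt (g j))

theorem sum_Cc_mul_eq_zero (hu : MemN1 u) (hg : ∀ i, ¬ (f < i ∧ i < l) → g i = 0) {j : Fin n}
    (hj : j ≤ f) : ∑ m, Cc (g m) * u m j = 0 := by
  refine Finset.sum_eq_zero fun m _ => ?_
  by_cases hm : f < m
  · rw [hu.1.2 m j (hj.trans_lt hm), mul_zero]
  · rw [hg m fun h => hm h.1, Cc_zero, zero_mul]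

theorem sliceMat_mul_first (j : Fin n) : (sliceMat f l c e b g * u) f j = Cc e * u l j :=
  sliceMat_first_dotProduct fun m => u m j

theorem sliceMat_mul_last (hfl : f < l) (j : Fin n) : (sliceMat f l c e b g * u) l j =
    (tK - Cc c) * u l j - Cc e⁻¹ * u f j - ∑ m, Cc (g m) * u m j :=
  sliceMat_last_dotProduct hfl fun m => u m j

theorem sliceMat_mul_mid {i : Fin n} (h1 : i ≠ f) (h2 : i ≠ l) (j : Fin n) :
    (sliceMat f l c e b g * u) i j = u i j + Cc (b i) * u l j :=
  sliceMat_mid_dotProduct h1 h2 fun m => u m j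

theorem sliceInv_mul_first (j : Fin n) : (sliceInv f l c e b g * u) f j =
    (tK - Cc (c - ∑ m, b m * g m)) * u f j - Cc e * u l j - Cc e * ∑ m, Cc (g m) * u m j :=
  sliceInv_first_dotProduct fun m => u m j

theorem sliceInv_mul_last (hfl : f < l) (j : Fin n) :
    (sliceInv f l c e b g * u) l j = Cc e⁻¹ * u f j :=
  sliceInv_last_dotProduct hfl fun m => u m j

theorem sliceInv_mul_mid {i : Fin n} (h1 : i ≠ f) (h2 : i ≠ l) (j : Fin n) :
    (sliceInv f l c e b g * u) i j = u i j - Cc (b i * e⁻¹) * u f j :=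
  sliceInv_mid_dotProduct h1 h2 fun m => u m j

theorem mul_shear_mul_tPow_apply (P : Matrix (Fin n) (Fin n) K) (x : Fin n → K) (ν : Fin n → ℤ)
    (i j : Fin n) :
    (P * (1 + Matrix.vecMulVec (Pi.single l 1) x) * tPow ν) i j =
      (P i j + P i l * x j) * tK ^ ν j := by
  rw [tPow, Matrix.mul_diagonal, mul_one_add_vecMulVec_apply]
  simp [Pi.single_apply]

theorem sliceMat_shear_isUpperUni (hfl : f < l) (he : e ≠ 0)
    (hb : ∀ i, ¬ (f < i ∧ i < l) → b i = 0) (hg : ∀ i, ¬ (f < i ∧ i < l) → g i = 0)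
    {a d : Fin n → K} (ha : ∀ i, f ≤ i → a i = 0) (hd : ∀ j, j ≤ l → d j = 0) :
    IsUpperUni (sliceInv f l c e b g * ((1 + Matrix.vecMulVec (-a) (Pi.single f 1)) *
      (1 + Matrix.vecMulVec (-Pi.single l 1) d)) * sliceMat f l c e b g) := by
  have hAA := sliceMat_mul_sliceInv (c := c) hfl he hb hg
  have hA'A := sliceInv_mul_sliceMat (c := c) hfl he hb hg
  have split : ∀ X Y : Matrix (Fin n) (Fin n) K,
      sliceInv f l c e b g * (X * Y) * sliceMat f l c e b g =
      (sliceInv f l c e b g * X * sliceMat f l c e b g) *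
        (sliceInv f l c e b g * Y * sliceMat f l c e b g) := fun X Y => by
    simp only [mul_assoc]
    rw [← mul_assoc (sliceMat f l c e b g), hAA, one_mul]
  rw [split, conj_one_add_vecMulVec hA'A, conj_one_add_vecMulVec hA'A]
  refine (isUpperUni_one_add_vecMulVec fun i j hij => ?_).mul
    (isUpperUni_one_add_vecMulVec fun i j hij => ?_)
  · have hj : (Pi.single f 1 ᵥ* sliceMat f l c e b g) j = (Pi.single l (Cc e) : Fin n → K) j := by
      simp [sliceMat]
    rw [hj]
    rcases eq_or_ne j l with rfl | hjl
    · suffices (sliceInv f j c e b g *ᵥ (-a)) i = 0 by rw [this, zero_mul]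
      rw [Matrix.mulVec]
      rcases eq_or_ne i j with rfl | hne
      · rw [sliceInv_last_dotProduct hfl, Pi.neg_apply, ha f le_rfl]
        simp
      · rw [sliceInv_mid_dotProduct (hfl.trans_le hij).ne' hne, Pi.neg_apply, Pi.neg_apply,
          ha f le_rfl, ha i (hfl.le.trans hij)]
        simp
    · simp [hjl]
  · rcases eq_or_ne i f with rfl | hif
    · suffices (d ᵥ* sliceMat i l c e b g) j = 0 by rw [this, mul_zero]
      rw [Matrix.vecMul]
      refine Finset.sum_eq_zero fun m _ => ?_
      by_cases hm : m ≤ l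
      · rw [hd m hm, zero_mul]
      · have hm := not_le.1 hm
        have h1 := (hfl.trans hm).ne'
        have h2 := (hij.trans_lt (hfl.trans hm)).ne
        simp [sliceMat, h1, hm.ne', hb m fun h => hm.not_gt h.2, Cc_zero, h2]
    · suffices (sliceInv f l c e b g *ᵥ (-Pi.single l 1)) i = 0 by rw [this, zero_mul]
      rw [Matrix.mulVec]
      rcases eq_or_ne i l with rfl | hil
      · rw [sliceInv_last_dotProduct hfl]
        simp [hfl.ne]
      · rw [sliceInv_mid_dotProduct hif hil]
        simp [hfl.ne, hil]

theorem sliceInv_shear_isUpperUni (hfl : f < l) (he : e ≠ 0)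
    (hb : ∀ i, ¬ (f < i ∧ i < l) → b i = 0) (hg : ∀ i, ¬ (f < i ∧ i < l) → g i = 0)
    {a d : Fin n → K} (ha : ∀ i, f ≤ i → a i = 0) (hd : ∀ j, j ≤ l → d j = 0) :
    IsUpperUni (sliceMat f l c e b g * ((1 + Matrix.vecMulVec (-a) (Pi.single l 1)) *
      (1 + Matrix.vecMulVec (-Pi.single f 1) d)) * sliceInv f l c e b g) := by
  have hAA := sliceMat_mul_sliceInv (c := c) hfl he hb hg
  have hA'A := sliceInv_mul_sliceMat (c := c) hfl he hb hg
  have split : ∀ X Y : Matrix (Fin n) (Fin n) K,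
      sliceMat f l c e b g * (X * Y) * sliceInv f l c e b g =
      (sliceMat f l c e b g * X * sliceInv f l c e b g) *
        (sliceMat f l c e b g * Y * sliceInv f l c e b g) := fun X Y => by
    simp only [mul_assoc]
    rw [← mul_assoc (sliceInv f l c e b g), hA'A, one_mul]
  rw [split, conj_one_add_vecMulVec hAA, conj_one_add_vecMulVec hAA]
  refine (isUpperUni_one_add_vecMulVec fun i j hij => ?_).mul
    (isUpperUni_one_add_vecMulVec fun i j hij => ?_)
  · have hj : (Pi.single l 1 ᵥ* sliceInv f l c e b g) j =
        (Pi.single f (Cc e⁻¹) : Fin n → K) j := by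
      simp [sliceInv, hfl.ne']
    rw [hj]
    rcases eq_or_ne j f with rfl | hjl
    · suffices (sliceMat j l c e b g *ᵥ (-a)) i = 0 by rw [this, zero_mul]
      rw [Matrix.mulVec]
      rcases eq_or_ne i j with rfl | hne
      · rw [sliceMat_first_dotProduct, Pi.neg_apply, ha l hfl.le]
        simp
      rcases eq_or_ne i l with rfl | hil
      · rw [sliceMat_last_dotProduct hfl, Pi.neg_apply, Pi.neg_apply, ha i hfl.le, ha j le_rfl,
          Finset.sum_eq_zero]
        · simp
        · intro m _
          by_cases hm : j < m
          · simp [ha m hm.le]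
          · simp [hg m fun h => hm h.1, Cc_zero]
      · rw [sliceMat_mid_dotProduct hne hil, Pi.neg_apply, Pi.neg_apply,
          ha i hij, ha l hfl.le]
        simp
    · simp [hjl]
  · rcases eq_or_ne i l with rfl | hil
    · suffices (d ᵥ* sliceInv f i c e b g) j = 0 by rw [this, mul_zero]
      rw [Matrix.vecMul]
      refine Finset.sum_eq_zero fun m _ => ?_
      by_cases hm : m ≤ i
      · rw [hd m hm, zero_mul]
      · have hm := not_le.1 hm
        have h1 := (hfl.trans hm).ne'
        have h2 := (hij.trans_lt hm).ne
        simp [sliceInv, h1, hm.ne', hb m fun h => hm.not_gt h.2, Cc_zero, h2]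
    · suffices (sliceMat f l c e b g *ᵥ (-Pi.single f 1)) i = 0 by rw [this, zero_mul]
      rw [Matrix.mulVec]
      rcases eq_or_ne i f with rfl | hif
      · rw [sliceMat_first_dotProduct]
        simp [hfl.ne']
      · rw [sliceMat_mid_dotProduct hif hil]
        simp [hfl.ne', hif]

theorem shear_memNpoly {p q : Fin n} {a d : Fin n → K} (ha : ∀ i, p ≤ i → a i = 0)
    (hd : ∀ j, j ≤ q → d j = 0) (ha' : ∀ i, a i ∈ polySubring) (hd' : ∀ i, d i ∈ polySubring) :
    MemNpoly ((1 + Matrix.vecMulVec (-a) (Pi.single p 1)) *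
      (1 + Matrix.vecMulVec (-Pi.single q 1) d)) := by
  have h1 : ∀ i j, (1 : Matrix (Fin n) (Fin n) K) i j ∈ polySubring := fun i j => by
    rw [Matrix.one_apply]
    split_ifs
    · exact one_mem _
    · exact zero_mem _
  refine MemNpoly.mul ⟨isUpperUni_one_add_vecMulVec fun i j hij => ?_, fun i j => ?_⟩
    ⟨isUpperUni_one_add_vecMulVec fun i j hij => ?_, fun i j => ?_⟩
  · rcases eq_or_ne j p with rfl | h
    · simp [ha i hij]
    · simp [h]
  · rw [Matrix.add_apply, Matrix.vecMulVec_apply]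
    exact add_mem (h1 i j) (mul_mem (neg_mem (ha' i)) (single_apply_mem _ _ _ (one_mem _)))
  · rcases eq_or_ne i q with rfl | h
    · simp [hd j hij]
    · simp [h]
  · rw [Matrix.add_apply, Matrix.vecMulVec_apply]
    exact add_mem (h1 i j) (mul_mem (neg_mem (single_apply_mem _ _ _ (one_mem _))) (hd' j))

theorem one_add_vecMulVec_mem_mfilt {x y : Fin n → K} (hx : ∀ i, x i ∈ filt 0)
    (hy : ∀ i, y i ∈ filt 0) : 1 + Matrix.vecMulVec x y ∈ mfilt n 0 :=
  add_mem one_mem_mfilt fun i j => mul_mem_filt' (hx i) (hy j)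

theorem single_one_mem_filt (p i : Fin n) : (Pi.single p 1 : Fin n → K) i ∈ filt 0 := by
  rw [Pi.single_apply]
  split_ifs
  · exact one_mem_filt
  · exact zero_mem _

theorem shear_mul_sub_one_mem {p q : Fin n} {a d β : Fin n → K} {S : Matrix (Fin n) (Fin n) K}
    (hfl : f < l) (hp : f ≤ p) (hq : q ≤ l) (ha : ∀ i, f ≤ i → a i = 0)
    (hd : ∀ j, j ≤ l → d j = 0) (hβ : ∀ i, l < i → β i = 0) (hβp : β p = 0)
    (ha' : ∀ i, a i ∈ filt 0) (hd' : ∀ i, d i ∈ filt 0) (hβ' : ∀ i, β i ∈ filt 0)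
    (hS : ∀ i j, S i j - ((1 : Matrix (Fin n) (Fin n) K) i j + (Pi.single q 1 : Fin n → K) i * d j +
      (a i + β i) * (Pi.single p 1 : Fin n → K) j) ∈ filt 1) :
    (1 + Matrix.vecMulVec (-a) (Pi.single p 1)) * (1 + Matrix.vecMulVec (-Pi.single q 1) d) * S *
      (1 + Matrix.vecMulVec (-β) (Pi.single p 1)) - 1 ∈ mfilt n 1 := by
  have hda : d ⬝ᵥ a = 0 := Finset.sum_eq_zero fun m _ => by
    rcases le_or_gt f m with h | h
    · rw [ha m h, mul_zero]
    · rw [hd m (h.trans hfl).le, zero_mul]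
  have hdβ : d ⬝ᵥ β = 0 := Finset.sum_eq_zero fun m _ => by
    rcases le_or_gt m l with h | h
    · rw [hd m h, zero_mul]
    · rw [hβ m h, mul_zero]
  have hS0 : (1 + Matrix.vecMulVec (Pi.single q 1) d) * (1 + Matrix.vecMulVec a (Pi.single p 1)) *
      (1 + Matrix.vecMulVec β (Pi.single p 1)) =
      1 + Matrix.vecMulVec (Pi.single q 1) d + Matrix.vecMulVec (a + β) (Pi.single p 1) := by
    rw [mul_assoc, one_add_mul_one_add (x := a) (by simp [hβp]), add_assoc 1, ← Matrix.add_vecMulVec,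
      one_add_mul_one_add (by rw [dotProduct_add, hda, hdβ, add_zero])]
  set S₀ := (1 + Matrix.vecMulVec (Pi.single q 1) d) *
    (1 + Matrix.vecMulVec a (Pi.single p 1)) * (1 + Matrix.vecMulVec β (Pi.single p 1)) with hS₀
  have h1 : (1 + Matrix.vecMulVec (-a) (Pi.single p 1)) *
      (1 + Matrix.vecMulVec (-Pi.single q 1) d) * S₀ *
      (1 + Matrix.vecMulVec (-β) (Pi.single p 1)) = 1 := by
    have e1 := one_add_neg_mul_one_add (x := a) (y := Pi.single p 1) (by simp [ha p hp])
    have e2 := one_add_neg_mul_one_add (x := Pi.single q 1) (y := d) (by simp [hd q hq])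
    have e3 := mul_eq_one_comm.1
      (one_add_neg_mul_one_add (x := β) (y := Pi.single p 1) (by simp [hβp]))
    calc _ = (1 + Matrix.vecMulVec (-a) (Pi.single p 1)) *
        ((1 + Matrix.vecMulVec (-Pi.single q 1) d) * (1 + Matrix.vecMulVec (Pi.single q 1) d)) *
        (1 + Matrix.vecMulVec a (Pi.single p 1)) *
        ((1 + Matrix.vecMulVec β (Pi.single p 1)) *
          (1 + Matrix.vecMulVec (-β) (Pi.single p 1))) := by
          simp only [hS₀, mul_assoc]
      _ = 1 := by rw [e2, e3, mul_one, mul_one, e1]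
  have hdiff : S - S₀ ∈ mfilt n 1 := fun i j => by
    rw [hS0, Matrix.sub_apply, Matrix.add_apply, Matrix.add_apply, Matrix.vecMulVec_apply,
      Matrix.vecMulVec_apply]
    exact hS i j
  nth_rw 4 [← h1]
  rw [← sub_mul, ← mul_sub]
  refine mul_mem_mfilt (a := 1) (b := 0) (mul_mem_mfilt (a := 0) (b := 1) (mul_mem_mfilt (a := 0)
    (b := 0) ?_ ?_) hdiff) ?_
  · exact one_add_vecMulVec_mem_mfilt (fun i => neg_mem (ha' i)) (single_one_mem_filt p)
  · exact one_add_vecMulVec_mem_mfilt (fun i => neg_mem (single_one_mem_filt q i)) hd'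
  · exact one_add_vecMulVec_mem_mfilt (fun i => neg_mem (hβ' i)) (single_one_mem_filt p)

theorem shear_mul_apply {p q : Fin n} {a d β : Fin n → K} {S : Matrix (Fin n) (Fin n) K}
    {i j : Fin n} (hi : a i = 0) (hj : j ≠ p)
    (h : (Pi.single q 1 : Fin n → K) i * ∑ m, d m * S m j = 0) :
    ((1 + Matrix.vecMulVec (-a) (Pi.single p 1)) * (1 + Matrix.vecMulVec (-Pi.single q 1) d) * S *
      (1 + Matrix.vecMulVec (-β) (Pi.single p 1))) i j = S i j := by
  rw [mul_one_add_vecMulVec_apply, mul_assoc, one_add_vecMulVec_mul_apply,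
    one_add_vecMulVec_mul_apply, Pi.neg_apply, Pi.neg_apply, hi, Pi.single_eq_of_ne hj]
  linear_combination -h

theorem exists_shear_sliceMat_mul (hfl : f < l) (he : e ≠ 0)
    (hb : ∀ i, ¬ (f < i ∧ i < l) → b i = 0) (hg : ∀ i, ¬ (f < i ∧ i < l) → g i = 0)
    (hu : MemN1 u) :
    ∃ V L M : Matrix (Fin n) (Fin n) K, MemNpoly V ∧ IsLowerUni L ∧ IsLowerUni M ∧
      IsUpperUni (sliceInv f l c e b g * V * sliceMat f l c e b g) ∧
      V * (sliceMat f l c e b g * u) * L * tPow (rootCoweight f l) * M - 1 ∈ mfilt n 1 ∧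
      ∀ u' d m, MemN1 u' → MemT1 d → MemN1neg m →
        V * (sliceMat f l c e b g * u) * L * tPow (rootCoweight f l) * M = u' * d * m →
        (u' f l).coeff 1 = e ∧ (u' f l).coeff 2 = c * e ∧
        ∀ i, f < i → i < l → (u' i l).coeff 1 = b i ∧ (u' f i).coeff 1 = e * g i := by
  have hee := Cc_mul_Cc_inv he
  have hT := mul_inv_cancel₀ tK_ne_zero
  set G : Fin n → K := fun j => ∑ m, Cc (g m) * u m j with hG
  have hG0 : ∀ j, G j ∈ filt 0 := sum_Cc_mul_mem_filt hu g
  have hGz : ∀ j, j ≤ f → G j = 0 := fun j => sum_Cc_mul_eq_zero hu hg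
  have hG1 : ∀ j, l ≤ j → G j ∈ filt 1 := fun j hj => by
    simpa [hg j fun h => h.2.not_ge hj, Cc_zero] using sum_Cc_mul_sub_mem_filt hu g j
  set P := sliceMat f l c e b g * u with hP
  have Pf : ∀ j, P f j = Cc e * u l j := sliceMat_mul_first
  have Pl : ∀ j, P l j = (tK - Cc c) * u l j - Cc e⁻¹ * u f j - G j := sliceMat_mul_last hfl
  have Pm : ∀ i, i ≠ f → i ≠ l → ∀ j, P i j = u i j + Cc (b i) * u l j :=
    fun i h1 h2 => sliceMat_mul_mid h1 h2
  have u1 : ∀ i j, i ≠ j → u i j ∈ filt 1 := fun i j => hu.mem_filt_one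
  have u0 : ∀ i j, u i j ∈ filt 0 := hu.mem_filt_zero
  have ud : ∀ i, u i i = 1 := hu.1.1
  have uz : ∀ i j, j < i → u i j = 0 := hu.1.2
  have c1 : ∀ z i j, i ≠ j → Cc z * u i j ∈ filt 1 := fun z i j hij =>
    mul_mem_filt' (Cc_mem_filt z) (u1 i j hij)
  set W := tK⁻¹ * P l l with hW
  have hW2 : W - (1 - Cc c * tK⁻¹) ∈ filt 2 := by
    have : W - (1 - Cc c * tK⁻¹) = -(tK⁻¹ * (Cc e⁻¹ * u f l + G l)) := by
      rw [hW, Pl, ud]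
      linear_combination hT
    rw [this]
    exact neg_mem (mul_mem_filt' tK_inv_mem_filt (add_mem (c1 _ _ _ hfl.ne) (hG1 l le_rfl)))
  have hW1 : W - 1 ∈ filt 1 := by
    have := sub_mem (filt_mono one_le_two hW2) (mul_mem_filt' (c := 1) (Cc_mem_filt c) tK_inv_mem_filt)
    rwa [sub_sub, sub_add_cancel] at this
  obtain ⟨hW0, hWi⟩ := inv_sub_one_mem_filt hW1
  have hWi0 : W⁻¹ ∈ filt 0 := by
    simpa using add_mem (filt_mono zero_le_one hWi) one_mem_filt
  have hWW := mul_inv_cancel₀ hW0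
  have hPll : P l l = tK * W := by rw [hW, ← mul_assoc, hT, one_mul]
  set x : Fin n → K := fun j => if f ≤ j ∧ j < l then -(P l j * tK⁻¹ * W⁻¹) else 0 with hx
  set a : Fin n → K := fun i => Cc (if i < f then (u i f).coeff 1 else 0) with ha
  set β : Fin n → K := fun i => Cc (b i * e⁻¹) with hβ
  set d : Fin n → K := fun j => Cc (if l < j then (u l j).coeff 1 else 0) with hd
  have a0 : ∀ i, f ≤ i → a i = 0 := fun i hi => by simp [ha, hi.not_gt, Cc_zero]
  have d0 : ∀ j, j ≤ l → d j = 0 := fun j hj => by simp [hd, hj.not_gt, Cc_zero]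
  have β0 : ∀ i, ¬ (f < i ∧ i < l) → β i = 0 := fun i hi => by simp [hβ, hb i hi, Cc_zero]
  have βf : β f = 0 := β0 f fun h => h.1.false
  have xl : x l = 0 := by simp [hx]
  have xm : ∀ j, f ≤ j → j < l → x j = -(P l j * tK⁻¹ * W⁻¹) := fun j h1 h2 => by simp [hx, h1, h2]
  set L : Matrix (Fin n) (Fin n) K := 1 + Matrix.vecMulVec (Pi.single l 1) x with hL
  set S := P * L * tPow (rootCoweight f l) with hS
  have hSa : ∀ i j, S i j = (P i j + P i l * x j) * tK ^ rootCoweight f l j :=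
    mul_shear_mul_tPow_apply P x _
  have Sf : ∀ i, S i f = (P i f + P i l * x f) * tK := fun i => by
    rw [hSa, rootCoweight, if_pos rfl, zpow_one]
  have Sl : ∀ i, S i l = P i l * tK⁻¹ := fun i => by
    rw [hSa, rootCoweight, if_neg hfl.ne', if_pos rfl, xl, mul_zero, add_zero, _root_.zpow_neg_one]
  have Sm : ∀ i j, f < j → j < l → S i j = P i j + P i l * x j := fun i j h1 h2 => by
    rw [hSa, rootCoweight, if_neg h1.ne', if_neg h2.ne, zpow_zero, mul_one]
  have So : ∀ i j, (j < f ∨ l < j) → S i j = P i j := fun i j h => by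
    have h1 : j ≠ f := by rintro rfl; exact h.elim (lt_irrefl _) hfl.not_gt
    have h2 : j ≠ l := by rintro rfl; exact h.elim hfl.not_gt (lt_irrefl _)
    have : x j = 0 := if_neg fun h' => h.elim h'.1.not_gt h'.2.not_gt
    rw [hSa, rootCoweight, if_neg h1, if_neg h2, zpow_zero, mul_one, this, mul_zero, add_zero]
  have x1 : ∀ j, f < j → j < l → x j ∈ filt 1 := fun j h1 h2 => by
    rw [xm j h1.le h2, Pl, uz l j h2]
    refine neg_mem (mul_mem_filt' (a := 1) (mul_mem_filt' (a := 0) ?_ tK_inv_mem_filt) hWi0)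
    rw [mul_zero, zero_sub]
    exact sub_mem (neg_mem (filt_mono zero_le_one (c1 _ _ _ h1.ne))) (hG0 j)
  have one_sub : ∀ i j, u i j - (1 : Matrix (Fin n) (Fin n) K) i j ∈ filt 1 :=
    (memN1_iff.1 hu).2
  have hS0 : ∀ i j, S i j - ((1 : Matrix (Fin n) (Fin n) K) i j +
      (Pi.single l 1 : Fin n → K) i * d j + (a i + β i) * (Pi.single f 1 : Fin n → K) j) ∈
      filt 1 := by
    intro i j
    have E0 : ∀ {p q : Fin n}, q ≠ p → (Pi.single p 1 : Fin n → K) q = 0 := fun h =>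
      Pi.single_eq_of_ne h 1
    have E1 : ∀ p : Fin n, (Pi.single p 1 : Fin n → K) p = 1 := fun p => Pi.single_eq_same p 1
    have d1 : ∀ j, l < j → tK * u l j - d j ∈ filt 1 := fun j hj => by
      simpa [hd, hj] using tK_mul_sub_Cc_mem_filt (u1 l j hj.ne)
    rcases lt_trichotomy j f with hj | rfl | hj
    · rw [So i j (Or.inl hj), d0 j (hj.trans hfl).le, E0 hj.ne, mul_zero, mul_zero, add_zero,
        add_zero]
      have hlj := uz l j (hj.trans hfl)
      rcases eq_or_ne i f with rfl | hif
      · rw [Pf, hlj, Matrix.one_apply_ne hj.ne', mul_zero, sub_zero]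
        exact zero_mem _
      rcases eq_or_ne i l with rfl | hil
      · rw [Pl, hlj, uz f j hj, hGz j hj.le, Matrix.one_apply_ne (hj.trans hfl).ne']
        simp
      · rw [Pm i hif hil, hlj, mul_zero, add_zero]
        exact one_sub i j
    · have Plj : P l j = -Cc e⁻¹ := by
        rw [Pl, uz l j hfl, ud, hGz j le_rfl]
        ring
      have xj : x j = Cc e⁻¹ * tK⁻¹ * W⁻¹ := by
        rw [xm j le_rfl hfl, Plj]
        ring
      rw [Sf, d0 j hfl.le, E1, mul_zero, add_zero, mul_one]
      rcases eq_or_ne i j with rfl | hij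
      · rw [Pf, Pf, uz l i hfl, ud, xj, Matrix.one_apply_eq, a0 i le_rfl, βf]
        have : (Cc e * 0 + Cc e * 1 * (Cc e⁻¹ * tK⁻¹ * W⁻¹)) * tK - (1 + (0 + 0)) = W⁻¹ - 1 := by
          linear_combination W⁻¹ * (tK * tK⁻¹) * hee + W⁻¹ * hT
        rw [this]
        exact hWi
      rcases eq_or_ne i l with rfl | hil
      · rw [Plj, hPll, xj, Matrix.one_apply_ne hij, a0 i hfl.le, β0 i fun h => h.2.false]
        have : (-Cc e⁻¹ + tK * W * (Cc e⁻¹ * tK⁻¹ * W⁻¹)) * tK - (0 + (0 + 0)) = 0 := by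
          linear_combination (Cc e⁻¹ * (W * W⁻¹) * tK) * hT + Cc e⁻¹ * tK * hWW
        rw [this]
        exact zero_mem _
      · have ha1 : tK * u i j - a i ∈ filt 1 := by
          rcases lt_or_gt_of_ne hij with h | h
          · simpa [ha, h] using tK_mul_sub_Cc_mem_filt (u1 i j hij)
          · rw [uz i j h, a0 i h.le, mul_zero, sub_zero]
            exact zero_mem _
        rw [Pm i hij hil, Pm i hij hil, uz l j hfl, ud, xj, Matrix.one_apply_ne hij]
        have : (u i j + Cc (b i) * 0 + (u i l + Cc (b i) * 1) * (Cc e⁻¹ * tK⁻¹ * W⁻¹)) * tK -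
            (0 + (a i + β i)) = (tK * u i j - a i) + u i l * (Cc e⁻¹ * W⁻¹) +
              Cc (b i) * Cc e⁻¹ * (W⁻¹ - 1) := by
          rw [show β i = Cc (b i) * Cc e⁻¹ from Cc_mul _ _]
          linear_combination ((u i l + Cc (b i)) * Cc e⁻¹ * W⁻¹) * hT
        rw [this]
        exact add_mem (add_mem ha1 (mul_mem_filt' (u1 i l hil)
          (mul_mem_filt' (c := 0) (Cc_mem_filt _) hWi0)))
          (mul_mem_filt' (mul_mem_filt' (c := 0) (Cc_mem_filt _) (Cc_mem_filt _)) hWi)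
    rcases lt_trichotomy j l with hjl | rfl | hjl
    · rw [Sm i j hj hjl, d0 j hjl.le, E0 hj.ne', mul_zero, mul_zero, add_zero, add_zero]
      have hlj := uz l j hjl
      rcases eq_or_ne i f with rfl | hif
      · rw [Pf, Pf, hlj, ud, Matrix.one_apply_ne hj.ne, mul_zero, zero_add, sub_zero, mul_one]
        exact mul_mem_filt' (Cc_mem_filt _) (x1 j hj hjl)
      rcases eq_or_ne i l with rfl | hil
      · rw [xm j hj.le hjl, hPll, Matrix.one_apply_ne hjl.ne']
        have : P i j + tK * W * -(P i j * tK⁻¹ * W⁻¹) - 0 = 0 := by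
          linear_combination (-P i j * (W * W⁻¹)) * hT - P i j * hWW
        rw [this]
        exact zero_mem _
      · rw [Pm i hif hil, hlj, mul_zero, add_zero, add_sub_right_comm]
        refine add_mem (one_sub i j) (mul_mem_filt' (a := 0) ?_ (x1 j hj hjl))
        rw [Pm i hif hil, ud, mul_one]
        exact add_mem (u0 i l) (Cc_mem_filt _)
    · rw [Sl, d0 j le_rfl, E0 hj.ne', mul_zero, mul_zero, add_zero, add_zero]
      rcases eq_or_ne i f with rfl | hif
      · rw [Pf, ud, mul_one, Matrix.one_apply_ne hj.ne, sub_zero]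
        exact mul_mem_filt' (Cc_mem_filt _) tK_inv_mem_filt
      rcases eq_or_ne i j with rfl | hij
      · rw [Matrix.one_apply_eq, mul_comm]
        exact hW1
      · rw [Pm i hif hij, ud, mul_one, Matrix.one_apply_ne hij, sub_zero]
        exact mul_mem_filt' (add_mem (u0 i j) (Cc_mem_filt _)) tK_inv_mem_filt
    · rw [So i j (Or.inr hjl), E0 hj.ne', mul_zero, add_zero]
      rcases eq_or_ne i l with rfl | hil
      · rw [Pl, E1, Matrix.one_apply_ne hjl.ne]
        have : (tK - Cc c) * u i j - Cc e⁻¹ * u f j - G j - (0 + 1 * d j) =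
            (tK * u i j - d j) - Cc c * u i j - Cc e⁻¹ * u f j - G j := by ring
        rw [this]
        exact sub_mem (sub_mem (sub_mem (d1 j hjl) (c1 _ _ _ hjl.ne)) (c1 _ _ _ hj.ne))
          (hG1 j hjl.le)
      rw [E0 hil, zero_mul, add_zero]
      rcases eq_or_ne i f with rfl | hif
      · rw [Pf, Matrix.one_apply_ne hj.ne, sub_zero]
        exact c1 _ _ _ hjl.ne
      · rw [Pm i hif hil, add_sub_right_comm]
        exact add_mem (one_sub i j) (c1 _ _ _ hjl.ne)
  refine ⟨(1 + Matrix.vecMulVec (-a) (Pi.single f 1)) * (1 + Matrix.vecMulVec (-Pi.single l 1) d),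
    L, 1 + Matrix.vecMulVec (-β) (Pi.single f 1), ?_, ?_, ?_, ?_, ?_, ?_⟩
  · exact shear_memNpoly a0 d0 (fun _ => Cc_mem_poly _) fun _ => Cc_mem_poly _
  · refine isLowerUni_one_add_vecMulVec fun i j hij => ?_
    rcases eq_or_ne i l with rfl | h
    · simp [hx, hij.not_gt]
    · simp [h]
  · refine isLowerUni_one_add_vecMulVec fun i j hij => ?_
    rcases eq_or_ne j f with rfl | h
    · simp [β0 i fun h => h.1.not_ge hij]
    · simp [h]
  · exact sliceMat_shear_isUpperUni hfl he hb hg a0 d0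
  · have := shear_mul_sub_one_mem hfl le_rfl le_rfl a0 d0 (fun i hi => β0 i fun h => h.2.not_gt hi)
      βf (fun _ => Cc_mem_filt _) (fun _ => Cc_mem_filt _) (fun _ => Cc_mem_filt _) hS0
    simpa only [hS, mul_assoc] using this
  · intro u' dd m hu' hdd hm hγ
    set γ := u' * dd * m with hγdef
    have hγ' : (1 + Matrix.vecMulVec (-a) (Pi.single f 1)) *
        (1 + Matrix.vecMulVec (-Pi.single l 1) d) * S *
        (1 + Matrix.vecMulVec (-β) (Pi.single f 1)) = γ := by
      rw [← hγ]
      simp only [hS, mul_assoc]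
    have γm : ∀ i j, f ≤ i → i ≠ l → j ≠ f → γ i j = S i j := fun i j h1 h2 h3 => by
      rw [← hγ']
      exact shear_mul_apply (a0 i h1) h3 (by simp [h2])
    have γl : γ l l = W := by
      rw [← hγ', shear_mul_apply (a0 l hfl.le) hfl.ne', Sl, mul_comm]
      rw [Finset.sum_eq_zero, mul_zero]
      intro m _
      rcases le_or_gt m l with h | h
      · rw [d0 m h, zero_mul]
      · rw [Sl, Pm m (hfl.trans h).ne' h.ne', uz m l h, hb m fun h' => h'.2.not_gt h, Cc_zero]
        simp
    have γfl : γ f l = Cc e * tK⁻¹ := by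
      rw [γm f l le_rfl hfl.ne hfl.ne', Sl, Pf, ud, mul_one]
    have k1 : (u' f l).coeff 1 = e := by
      rw [coeff_eq_of_sub_mem_filt (upper_sub_mem_filt hu' hdd hm hγdef hfl) one_lt_two, γfl,
        coeff_Cc_mul_tK_inv_one]
    refine ⟨k1, ?_, fun i h1 h2 => ⟨?_, ?_⟩⟩
    · have h3 := upper_mul_sub_mem_filt hu' hdd hm hγdef hfl fun m h => by
        rw [γm m l (hfl.trans h).le h.ne' hfl.ne', Sl, Pm m (hfl.trans h).ne' h.ne', uz m l h,
          hb m fun h' => h'.2.not_gt h, Cc_zero]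
        simp
      have h4 := sub_mem h3 (mul_mem_filt' (c := 3) (hu'.mem_filt_one hfl.ne) hW2)
      rw [γl, γfl] at h4
      have h5 : u' f l * W - Cc e * tK⁻¹ - u' f l * (W - (1 - Cc c * tK⁻¹)) =
          u' f l - (Cc e * tK⁻¹ + Cc c * (tK⁻¹ * u' f l)) := by ring
      rw [h5] at h4
      rw [coeff_eq_of_sub_mem_filt h4 (by norm_num), HahnSeries.coeff_add,
        coeff_Cc_mul_tK_inv_two, coeff_Cc_mul, coeff_tK_inv_mul, zero_add]
      norm_num [k1]
    · have h3 := upper_sub_mem_filt hu' hdd hm hγdef h2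
      rw [γm i l h1.le h2.ne hfl.ne', Sl, Pm i h1.ne' h2.ne, ud, mul_one] at h3
      have h4 := add_mem h3 (mul_mem_filt' (c := 2) (u1 i l h2.ne) tK_inv_mem_filt)
      have h5 : u' i l - (u i l + Cc (b i)) * tK⁻¹ + u i l * tK⁻¹ = u' i l - Cc (b i) * tK⁻¹ := by
        ring
      rw [h5] at h4
      rw [coeff_eq_of_sub_mem_filt h4 one_lt_two, coeff_Cc_mul_tK_inv_one]
    · have h3 := upper_sub_mem_filt hu' hdd hm hγdef h1
      rw [γm f i le_rfl hfl.ne h1.ne', Sm f i h1 h2, Pf, Pf, uz l i h2, ud, xm i h1.le h2, Pl,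
        uz l i h2] at h3
      have h4 : Cc (e * g i) * tK⁻¹ - (u f i * tK⁻¹ * W⁻¹ + Cc e * G i * tK⁻¹ * W⁻¹) ∈ filt 2 := by
        have : Cc (e * g i) * tK⁻¹ - (u f i * tK⁻¹ * W⁻¹ + Cc e * G i * tK⁻¹ * W⁻¹) =
            -(u f i * tK⁻¹ * W⁻¹) - Cc e * (G i - Cc (g i)) * tK⁻¹ * W⁻¹ -
              Cc e * Cc (g i) * tK⁻¹ * (W⁻¹ - 1) := by
          rw [Cc_mul]
          ring
        rw [this]
        refine sub_mem (sub_mem (neg_mem ?_) ?_) ?_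
        · exact mul_mem_filt' (a := 2) (mul_mem_filt' (u1 f i h1.ne) tK_inv_mem_filt) hWi0
        · exact mul_mem_filt' (a := 2) (mul_mem_filt' (a := 1) (mul_mem_filt' (Cc_mem_filt _)
            (sum_Cc_mul_sub_mem_filt hu g i)) tK_inv_mem_filt) hWi0
        · exact mul_mem_filt' (a := 1) (mul_mem_filt' (a := 0) (mul_mem_filt' (Cc_mem_filt _)
            (Cc_mem_filt _)) tK_inv_mem_filt) hWi
      have h5 := sub_mem h3 h4
      have h6 : u' f i - (Cc e * 0 + Cc e * 1 *
          -(((tK - Cc c) * 0 - Cc e⁻¹ * u f i - G i) * tK⁻¹ * W⁻¹)) -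
          (Cc (e * g i) * tK⁻¹ - (u f i * tK⁻¹ * W⁻¹ + Cc e * G i * tK⁻¹ * W⁻¹)) =
          u' f i - Cc (e * g i) * tK⁻¹ := by
        linear_combination (-(u f i * tK⁻¹ * W⁻¹)) * hee
      rw [h6] at h5
      rw [coeff_eq_of_sub_mem_filt h5 one_lt_two, coeff_Cc_mul_tK_inv_one]

theorem exists_shear_sliceInv_mul (hfl : f < l) (he : e ≠ 0)
    (hb : ∀ i, ¬ (f < i ∧ i < l) → b i = 0) (hg : ∀ i, ¬ (f < i ∧ i < l) → g i = 0)
    (hu : MemN1 u) (h1 : (u f l).coeff 1 = e) (h2 : (u f l).coeff 2 = c * e)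
    (hub : ∀ i, f < i → i < l → (u i l).coeff 1 = b i)
    (hug : ∀ i, f < i → i < l → (u f i).coeff 1 = e * g i) :
    ∃ V L : Matrix (Fin n) (Fin n) K, MemNpoly V ∧ IsLowerUni L ∧
      IsUpperUni (sliceMat f l c e b g * V * sliceInv f l c e b g) ∧
      V * (sliceInv f l c e b g * u) * L * tPow (-rootCoweight f l) * 1 - 1 ∈ mfilt n 1 := by
  have hee := Cc_mul_Cc_inv he
  have hT := mul_inv_cancel₀ tK_ne_zero
  set G : Fin n → K := fun j => ∑ m, Cc (g m) * u m j with hG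
  have hG0 : ∀ j, G j ∈ filt 0 := sum_Cc_mul_mem_filt hu g
  have hGz : ∀ j, j ≤ f → G j = 0 := fun j => sum_Cc_mul_eq_zero hu hg
  set P := sliceInv f l c e b g * u with hP
  have Pf : ∀ j, P f j = (tK - Cc (c - ∑ m, b m * g m)) * u f j - Cc e * u l j - Cc e * G j :=
    sliceInv_mul_first
  have Pl : ∀ j, P l j = Cc e⁻¹ * u f j := sliceInv_mul_last hfl
  have Pm : ∀ i, i ≠ f → i ≠ l → ∀ j, P i j = u i j - Cc (b i * e⁻¹) * u f j :=
    fun i h1 h2 => sliceInv_mul_mid h1 h2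
  have u1 : ∀ i j, i ≠ j → u i j ∈ filt 1 := fun i j => hu.mem_filt_one
  have u0 : ∀ i j, u i j ∈ filt 0 := hu.mem_filt_zero
  have ud : ∀ i, u i i = 1 := hu.1.1
  have uz : ∀ i j, j < i → u i j = 0 := hu.1.2
  have c1 : ∀ z i j, i ≠ j → Cc z * u i j ∈ filt 1 := fun z i j hij =>
    mul_mem_filt' (Cc_mem_filt z) (u1 i j hij)
  set p : ℂ := c - ∑ m, b m * g m with hp
  set W := tK * u f l * Cc e⁻¹ with hW
  have hTe : tK * u f l - Cc e ∈ filt 1 := by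
    rw [← h1]
    exact tK_mul_sub_Cc_mem_filt (u1 f l hfl.ne)
  have hW1 : W - 1 ∈ filt 1 := by
    rw [hW, ← hee, ← sub_mul]
    exact mul_mem_filt' hTe (Cc_mem_filt _)
  obtain ⟨hW0, hWi⟩ := inv_sub_one_mem_filt hW1
  have hWi0 : W⁻¹ ∈ filt 0 := by
    simpa using add_mem (filt_mono zero_le_one hWi) one_mem_filt
  have hWW : tK * u f l * Cc e⁻¹ * W⁻¹ = 1 := mul_inv_cancel₀ hW0
  have hu2 : ∀ i, f < i → i < l → u i l - Cc (b i) * tK⁻¹ ∈ filt 2 := fun i h h' => by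
    rw [← hub i h h']
    exact sub_Cc_mul_tK_inv_mem_filt (u1 i l h'.ne)
  have hz2 : u f l - Cc e * tK⁻¹ ∈ filt 2 := by
    rw [← h1]
    exact sub_Cc_mul_tK_inv_mem_filt (u1 f l hfl.ne)
  have hz3 : tK * u f l - Cc e - Cc (c * e) * tK⁻¹ ∈ filt 2 := by
    have h := sub_Cc_mul_tK_inv_mem_filt hTe
    rwa [HahnSeries.coeff_sub, coeff_tK_mul, show (1 : ℤ) + 1 = 2 from rfl, h2,
      show (Cc e).coeff 1 = 0 by simp [Cc, HahnSeries.C_apply], sub_zero] at h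
  have hGl : G l - Cc (∑ m, b m * g m) * tK⁻¹ ∈ filt 2 := by
    rw [hG, Cc_sum, Finset.sum_mul, ← Finset.sum_sub_distrib]
    refine sum_mem fun m _ => ?_
    by_cases hm : f < m ∧ m < l
    · have : Cc (g m) * u m l - Cc (b m * g m) * tK⁻¹ =
          Cc (g m) * (u m l - Cc (b m) * tK⁻¹) := by
        rw [Cc_mul]
        ring
      rw [this]
      exact mul_mem_filt' (Cc_mem_filt _) (hu2 m hm.1 hm.2)
    · rw [hg m hm, mul_zero, Cc_zero, zero_mul, zero_mul, sub_zero]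
      exact zero_mem _
  have Pfl : P f l ∈ filt 2 := by
    have : P f l = (tK * u f l - Cc e - Cc (c * e) * tK⁻¹) - Cc p * (u f l - Cc e * tK⁻¹) -
        Cc e * (G l - Cc (∑ m, b m * g m) * tK⁻¹) := by
      rw [Pf, ud, hp, Cc_sub, Cc_mul]
      ring
    rw [this]
    exact sub_mem (sub_mem hz3 (mul_mem_filt' (Cc_mem_filt _) hz2))
      (mul_mem_filt' (Cc_mem_filt _) hGl)
  have Pil : ∀ i, f < i → i ≠ l → P i l ∈ filt 2 := fun i hi hil => by
    rw [Pm i hi.ne' hil]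
    rcases lt_or_gt_of_ne hil with h | h
    · have : u i l - Cc (b i * e⁻¹) * u f l = (u i l - Cc (b i) * tK⁻¹) -
          Cc (b i * e⁻¹) * (u f l - Cc e * tK⁻¹) := by
        rw [Cc_mul]
        linear_combination -Cc (b i) * tK⁻¹ * hee
      rw [this]
      exact sub_mem (hu2 i hi h) (mul_mem_filt' (Cc_mem_filt _) hz2)
    · rw [uz i l h, hb i fun h' => h'.2.not_gt h, zero_mul, Cc_zero, zero_mul, sub_zero]
      exact zero_mem _
  have Pil' : ∀ i, i < f → ∀ j, P i j = u i j := fun i hi j => by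
    rw [Pm i hi.ne (hi.trans hfl).ne, hb i fun h => h.1.not_gt hi, zero_mul, Cc_zero, zero_mul,
      sub_zero]
  have Pil1 : ∀ i, i ≠ f → i ≠ l → P i l ∈ filt 1 := fun i hi hil => by
    rw [Pm i hi hil]
    exact sub_mem (u1 i l hil) (c1 _ _ _ hfl.ne)
  have Pfj : ∀ j, f < j → j < l → P f j ∈ filt 1 := fun j hj hjl => by
    have : P f j = (tK * u f j - Cc (e * g j)) - Cc p * u f j - Cc e * (G j - Cc (g j)) := by
      rw [Pf, uz l j hjl, Cc_mul]
      ring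
    rw [this, ← hug j hj hjl]
    exact sub_mem (sub_mem (tK_mul_sub_Cc_mem_filt (u1 f j hj.ne)) (c1 _ _ _ hj.ne))
      (mul_mem_filt' (Cc_mem_filt _) (sum_Cc_mul_sub_mem_filt hu g j))
  have Pfj0 : ∀ j, f < j → P f j ∈ filt 0 := fun j hj => by
    rw [Pf, sub_mul]
    exact sub_mem (sub_mem (sub_mem (mul_mem_filt' tK_mem_filt (u1 f j hj.ne))
      (mul_mem_filt' (Cc_mem_filt _) (u0 f j))) (mul_mem_filt' (Cc_mem_filt _) (u0 l j)))
      (mul_mem_filt' (Cc_mem_filt _) (hG0 j))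
  set x : Fin n → K := fun j => if f ≤ j ∧ j < l then -(u f j * tK * Cc e⁻¹ * W⁻¹) else 0 with hx
  set a : Fin n → K := fun i => Cc (if i < f then (u i l).coeff 1 else 0) with ha
  set d : Fin n → K := fun j => Cc (if l < j then (P f j).coeff 0 else 0) with hd
  have a0 : ∀ i, f ≤ i → a i = 0 := fun i hi => by simp [ha, hi.not_gt, Cc_zero]
  have d0 : ∀ j, j ≤ l → d j = 0 := fun j hj => by simp [hd, hj.not_gt, Cc_zero]
  have xl : x l = 0 := by simp [hx]
  have xm : ∀ j, f ≤ j → j < l → x j = -(u f j * tK * Cc e⁻¹ * W⁻¹) :=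
    fun j h1 h2 => by simp [hx, h1, h2]
  set L : Matrix (Fin n) (Fin n) K := 1 + Matrix.vecMulVec (Pi.single l 1) x with hL
  set S := P * L * tPow (-rootCoweight f l) with hS
  have hSa : ∀ i j, S i j = (P i j + P i l * x j) * tK ^ (-rootCoweight f l) j :=
    mul_shear_mul_tPow_apply P x _
  have Sf : ∀ i, S i f = (P i f + P i l * x f) * tK⁻¹ := fun i => by
    rw [hSa, Pi.neg_apply, rootCoweight, if_pos rfl, _root_.zpow_neg_one]
  have Sl : ∀ i, S i l = P i l * tK := fun i => by
    rw [hSa, Pi.neg_apply, rootCoweight, if_neg hfl.ne', if_pos rfl, xl, mul_zero, add_zero,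
      neg_neg, zpow_one]
  have Sm : ∀ i j, f < j → j < l → S i j = P i j + P i l * x j := fun i j h1 h2 => by
    rw [hSa, Pi.neg_apply, rootCoweight, if_neg h1.ne', if_neg h2.ne, neg_zero, zpow_zero, mul_one]
  have So : ∀ i j, (j < f ∨ l < j) → S i j = P i j := fun i j h => by
    have h1 : j ≠ f := by rintro rfl; exact h.elim (lt_irrefl _) hfl.not_gt
    have h2 : j ≠ l := by rintro rfl; exact h.elim hfl.not_gt (lt_irrefl _)
    have : x j = 0 := if_neg fun h' => h.elim h'.1.not_gt h'.2.not_gt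
    rw [hSa, Pi.neg_apply, rootCoweight, if_neg h1, if_neg h2, neg_zero, zpow_zero, mul_one, this,
      mul_zero, add_zero]
  have x0 : ∀ j, f < j → j < l → x j ∈ filt 0 := fun j h1 h2 => by
    rw [xm j h1.le h2]
    exact neg_mem (mul_mem_filt' (a := 0) (mul_mem_filt' (a := 0) (mul_mem_filt' (u1 f j h1.ne)
      tK_mem_filt) (Cc_mem_filt _)) hWi0)
  have one_sub : ∀ i j, u i j - (1 : Matrix (Fin n) (Fin n) K) i j ∈ filt 1 :=
    (memN1_iff.1 hu).2
  have hS0 : ∀ i j, S i j - ((1 : Matrix (Fin n) (Fin n) K) i j +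
      (Pi.single f 1 : Fin n → K) i * d j + (a i + (0 : Fin n → K) i) *
      (Pi.single l 1 : Fin n → K) j) ∈ filt 1 := by
    intro i j
    rw [Pi.zero_apply, add_zero]
    have E0 : ∀ {p q : Fin n}, q ≠ p → (Pi.single p 1 : Fin n → K) q = 0 := fun h =>
      Pi.single_eq_of_ne h 1
    have E1 : ∀ p : Fin n, (Pi.single p 1 : Fin n → K) p = 1 := fun p => Pi.single_eq_same p 1
    rcases lt_trichotomy j f with hj | rfl | hj
    · rw [So i j (Or.inl hj), d0 j (hj.trans hfl).le, E0 (hj.trans hfl).ne, mul_zero, mul_zero,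
        add_zero, add_zero]
      have hfj := uz f j hj
      rcases eq_or_ne i f with rfl | hif
      · rw [Pf, hfj, uz l j (hj.trans hfl), hGz j hj.le, Matrix.one_apply_ne hj.ne']
        simp
      rcases eq_or_ne i l with rfl | hil
      · rw [Pl, hfj, Matrix.one_apply_ne (hj.trans hfl).ne', mul_zero, sub_zero]
        exact zero_mem _
      · rw [Pm i hif hil, hfj, mul_zero, sub_zero]
        exact one_sub i j
    · have xj : x j = -(tK * Cc e⁻¹ * W⁻¹) := by rw [xm j le_rfl hfl, ud, one_mul]
      rw [Sf, d0 j hfl.le, E0 hfl.ne, mul_zero, mul_zero, add_zero, add_zero]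
      rcases eq_or_ne i j with rfl | hij
      · have : (P i i + P i l * x i) * tK⁻¹ - (1 : Matrix (Fin n) (Fin n) K) i i =
            -(Cc p * tK⁻¹) - P i l * (Cc e⁻¹ * W⁻¹) := by
          rw [Pf i, ud, uz l i hfl, hGz i le_rfl, xj, Matrix.one_apply_eq]
          linear_combination (1 - P i l * Cc e⁻¹ * W⁻¹) * hT
        rw [this]
        exact sub_mem (neg_mem (mul_mem_filt' (Cc_mem_filt _) tK_inv_mem_filt))
          (mul_mem_filt' (filt_mono one_le_two Pfl) (mul_mem_filt' (c := 0) (Cc_mem_filt _) hWi0))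
      rcases eq_or_ne i l with rfl | hil
      · rw [Pl, Pl, ud, xj, Matrix.one_apply_ne hij]
        have : (Cc e⁻¹ * 1 + Cc e⁻¹ * u j i * -(tK * Cc e⁻¹ * W⁻¹)) * tK⁻¹ - 0 = 0 := by
          linear_combination (-Cc e⁻¹ * tK⁻¹) * hWW
        rw [this]
        exact zero_mem _
      · have : (P i j + P i l * x j) * tK⁻¹ =
            (u i j - Cc (b i * e⁻¹)) * tK⁻¹ - P i l * (Cc e⁻¹ * W⁻¹) := by
          rw [Pm i hij hil j, ud, xj]
          linear_combination (-P i l * Cc e⁻¹ * W⁻¹) * hT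
        rw [this, Matrix.one_apply_ne hij, sub_zero]
        exact sub_mem (mul_mem_filt' (sub_mem (u0 i j) (Cc_mem_filt _)) tK_inv_mem_filt)
          (mul_mem_filt' (Pil1 i hij hil) (mul_mem_filt' (c := 0) (Cc_mem_filt _) hWi0))
    rcases lt_trichotomy j l with hjl | rfl | hjl
    · rw [Sm i j hj hjl, d0 j hjl.le, E0 hjl.ne, mul_zero, mul_zero, add_zero, add_zero]
      rcases eq_or_ne i f with rfl | hif
      · rw [Matrix.one_apply_ne hj.ne, sub_zero]
        exact add_mem (Pfj j hj hjl) (mul_mem_filt' (filt_mono one_le_two Pfl) (x0 j hj hjl))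
      rcases eq_or_ne i l with rfl | hil
      · rw [Pl, Pl, xm j hj.le hjl, Matrix.one_apply_ne hjl.ne']
        have : Cc e⁻¹ * u f j + Cc e⁻¹ * u f i * -(u f j * tK * Cc e⁻¹ * W⁻¹) - 0 = 0 := by
          linear_combination (-Cc e⁻¹ * u f j) * hWW
        rw [this]
        exact zero_mem _
      · rw [Pm i hif hil j, add_sub_right_comm, sub_right_comm]
        exact add_mem (sub_mem (one_sub i j) (c1 _ _ _ hj.ne))
          (mul_mem_filt' (Pil1 i hif hil) (x0 j hj hjl))
    · rw [Sl, d0 j le_rfl, E1, mul_zero, add_zero, mul_one]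
      rcases eq_or_ne i j with rfl | hij
      · rw [Pl, a0 i hj.le, Matrix.one_apply_eq, add_zero]
        have : Cc e⁻¹ * u f i * tK = W := by
          rw [hW]
          ring
        rw [this]
        exact hW1
      rw [Matrix.one_apply_ne hij, zero_add]
      rcases lt_trichotomy i f with hi | rfl | hi
      · rw [Pil' i hi, mul_comm]
        simpa [ha, hi] using tK_mul_sub_Cc_mem_filt (u1 i j hij)
      · rw [a0 i le_rfl, sub_zero]
        exact mul_mem_filt' Pfl tK_mem_filt
      · rw [a0 i hi.le, sub_zero]
        exact mul_mem_filt' (Pil i hi hij) tK_mem_filt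
    · rw [So i j (Or.inr hjl), E0 hjl.ne', mul_zero, add_zero]
      rcases eq_or_ne i f with rfl | hif
      · rw [E1, Matrix.one_apply_ne hj.ne, zero_add, one_mul]
        simpa [hd, hjl] using sub_Cc_mem_filt (Pfj0 j hj)
      rw [E0 hif, zero_mul, add_zero]
      rcases eq_or_ne i l with rfl | hil
      · rw [Pl, Matrix.one_apply_ne hjl.ne, sub_zero]
        exact c1 _ _ _ hj.ne
      · rw [Pm i hif hil, sub_right_comm]
        exact sub_mem (one_sub i j) (c1 _ _ _ hj.ne)
  refine ⟨(1 + Matrix.vecMulVec (-a) (Pi.single l 1)) * (1 + Matrix.vecMulVec (-Pi.single f 1) d),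
    L, ?_, ?_, ?_, ?_⟩
  · exact shear_memNpoly (fun i hi => a0 i (hfl.le.trans hi)) (fun j hj => d0 j (hj.trans hfl.le))
      (fun _ => Cc_mem_poly _) fun _ => Cc_mem_poly _
  · refine isLowerUni_one_add_vecMulVec fun i j hij => ?_
    rcases eq_or_ne i l with rfl | h
    · simp [hx, hij.not_gt]
    · simp [h]
  · exact sliceInv_shear_isUpperUni hfl he hb hg a0 d0
  · have := shear_mul_sub_one_mem (β := 0) hfl hfl.le hfl.le a0 d0
      (fun i _ => Pi.zero_apply i) (Pi.zero_apply l) (fun _ => Cc_mem_filt _) (fun _ => Cc_mem_filt _)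
      (fun _ => zero_mem _) hS0
    simpa only [hS, mul_assoc, neg_zero, Matrix.zero_vecMulVec, add_zero, mul_one] using this

end Multiplication

section Comparison

variable {n : ℕ} {f l : Fin n} {c e : ℂ} {b g : Fin n → ℂ}

theorem isPiOf_of_eq_mul {ν : Fin n → ℤ} {A A' V B y z : Matrix (Fin n) (Fin n) K}
    (hy : y ∈ GrSlice ν) (hAp : ∀ i j, A i j ∈ polySubring)
    (hAp' : ∀ i j, A' i j ∈ polySubring) (hV : MemNpoly V) (hU : IsUpperUni (A' * V * A))
    (hB : MemNnegPoly B) (hz : z = V * (A * y) * B) : IsPiOf ν (A' * z) y := by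
  have hP : MemNpoly (A' * V * A) :=
    ⟨hU, mul_apply_mem polySubring (mul_apply_mem polySubring hAp' hV.2) hAp⟩
  refine ⟨hy, (A' * V * A)⁻¹, B⁻¹, hP.inv, hB.inv, ?_⟩
  have h1 : A' * z = (A' * V * A) * y * B := by
    rw [hz]
    simp only [mul_assoc]
  rw [h1, ← mul_assoc, ← mul_assoc, hU.inv_mul, one_mul, mul_assoc, hB.1.mul_inv, mul_one]

theorem exists_isPiOf_sliceMat_mul (hfl : f < l) (he : e ≠ 0)
    (hb : ∀ i, ¬ (f < i ∧ i < l) → b i = 0) (hg : ∀ i, ¬ (f < i ∧ i < l) → g i = 0)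
    {μ ν : Fin n → ℤ} (hν : ν = μ + rootCoweight f l) {y : Matrix (Fin n) (Fin n) K}
    (hy : y ∈ GrSlice ν) :
    ∃ z u h m, IsGauss μ z u h m ∧ IsPiOf μ (sliceMat f l c e b g * y) z ∧
      IsPiOf ν (sliceInv f l c e b g * z) y ∧
      (u f l).coeff 1 = e ∧ (u f l).coeff 2 = c * e ∧
      ∀ i, f < i → i < l → (u i l).coeff 1 = b i ∧ (u f i).coeff 1 = e * g i := by
  obtain ⟨u, h, m, H⟩ := hy
  obtain ⟨V, L, M, hV, hL, hM, hU, hγ, hc⟩ :=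
    exists_shear_sliceMat_mul (c := c) hfl he hb hg H.1
  obtain ⟨z, u', h', l', B, d, m', H', hB, hz, hd, hm, e'⟩ :=
    H.exists_pi (β := -rootCoweight f l) hL hM (by rwa [neg_neg])
  rw [hν, add_neg_cancel_right] at H'
  rw [neg_neg] at e'
  exact ⟨z, u', h', l', H', ⟨⟨_, _, _, H'⟩, V, B, hV, hB, hz⟩,
    isPiOf_of_eq_mul ⟨u, h, m, H⟩ sliceMat_apply_mem
      sliceInv_apply_mem hV hU hB hz, hc u' d m' H'.1 hd hm e'⟩

theorem exists_isPiOf_sliceInv_mul (hfl : f < l) (he : e ≠ 0)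
    (hb : ∀ i, ¬ (f < i ∧ i < l) → b i = 0) (hg : ∀ i, ¬ (f < i ∧ i < l) → g i = 0)
    {μ ν : Fin n → ℤ} (hν : ν = μ + rootCoweight f l) {y u h m : Matrix (Fin n) (Fin n) K}
    (H : IsGauss μ y u h m) (h1 : (u f l).coeff 1 = e) (h2 : (u f l).coeff 2 = c * e)
    (hub : ∀ i, f < i → i < l → (u i l).coeff 1 = b i)
    (hug : ∀ i, f < i → i < l → (u f i).coeff 1 = e * g i) :
    ∃ z, IsPiOf ν (sliceInv f l c e b g * y) z ∧ IsPiOf μ (sliceMat f l c e b g * z) y := by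
  obtain ⟨V, L, hV, hL, hU, hγ⟩ := exists_shear_sliceInv_mul hfl he hb hg H.1 h1 h2 hub hug
  obtain ⟨z, u', h', l', B, d, m', H', hB, hz, -⟩ :=
    H.exists_pi (β := rootCoweight f l) hL ⟨by simp, fun i j h => by simp [h.ne]⟩ hγ
  rw [← hν] at H'
  exact ⟨z, ⟨⟨_, _, _, H'⟩, V, B, hV, hB, hz⟩,
    isPiOf_of_eq_mul ⟨u, h, m, H⟩ sliceInv_apply_mem
      sliceMat_apply_mem hV hU hB hz⟩

theorem sliceMat_apply (i j : Fin n) : sliceMat f l c e b g i j =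
    if i = f then (if j = l then Cc e else 0)
    else if i = l then
      (if j = l then tK - Cc c else 0) - (if j = f then Cc e⁻¹ else 0) - Cc (g j)
    else (if j = i then 1 else 0) + (if j = l then Cc (b i) else 0) := by
  unfold sliceMat
  split_ifs <;> simp_all

end Comparison

section Embedding

variable {n r₁ r₂ k : ℕ}

/-- Extension of `v`, with reversed indices, by zero outside the open interval `(r₁ - 1, r₂)`. -/
def extendMid (n r₁ r₂ k : ℕ) (hr1 : 1 ≤ r₁) (hrr : r₁ ≤ r₂) (hk : k = r₂ - r₁ + 1)
    (v : Fin (k - 1) → ℂ) : Fin n → ℂ :=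
  fun i => if h : r₁ - 1 < (i : ℕ) ∧ (i : ℕ) < r₂ then v ⟨r₂ - 1 - i, by omega⟩ else 0

theorem blockEmbed_ymat (hr1 : 1 ≤ r₁) (hrr : r₁ ≤ r₂) (hrn : r₂ < n) (hk : k = r₂ - r₁ + 1)
    (p e : ℂ) (b g : Fin (k - 1) → ℂ) :
    blockEmbed n r₁ k (ymat k p e b g) =
      sliceMat ⟨r₁ - 1, by omega⟩ ⟨r₂, hrn⟩ (p + ∑ i, b i * g i) e
        (extendMid n r₁ r₂ k hr1 hrr hk b) (extendMid n r₁ r₂ k hr1 hrr hk g) := by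
  ext1 i j
  obtain ⟨i, hi⟩ := i
  obtain ⟨j, hj⟩ := j
  rw [sliceMat_apply]
  simp only [blockEmbed, ymat, extendMid, Fin.mk.injEq]
  have hmid : ∀ (v : Fin (k - 1) → ℂ) (x : ℕ) (h h'), r₁ - 1 < x → x < r₂ →
      v ⟨k - (x - (r₁ - 1)) - 1, h⟩ = v ⟨r₂ - 1 - x, h'⟩ := fun v x h h' h1 h2 => by
    congr 2
    omega
  split_ifs <;> first
    | (exfalso; omega)
    | (simp [Cc_neg, Cc_zero]; done)
    | (simp [Cc_neg]; exact congrArg Cc (hmid _ _ _ _ (by omega) (by omega)))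

theorem alphaCo_eq_rootCoweight (hr1 : 1 ≤ r₁) (hrr : r₁ ≤ r₂) (hrn : r₂ < n) :
    alphaCo n r₁ r₂ = rootCoweight ⟨r₁ - 1, by omega⟩ ⟨r₂, hrn⟩ := by
  ext1 i
  simp [alphaCo, rootCoweight, Fin.ext_iff]

theorem xiOf_eq_sliceMat (hr1 : 1 ≤ r₁) (hrr : r₁ ≤ r₂) (hrn : r₂ < n) (hk : k = r₂ - r₁ + 1)
    {f l : Fin n} (hf : f = ⟨r₁ - 1, by omega⟩) (hl : l = ⟨r₂, hrn⟩)
    (u : Matrix (Fin n) (Fin n) K) :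
    xiOf n r₁ r₂ k hr1 hrr hrn hk u =
      sliceMat f l ((u f l).coeff 2 / (u f l).coeff 1) ((u f l).coeff 1)
        (fun i => if f < i ∧ i < l then (u i l).coeff 1 else 0)
        (fun i => if f < i ∧ i < l then (u f i).coeff 1 / (u f l).coeff 1 else 0) := by
  have hfi : ∀ h, (⟨r₂ - 1 - (k - 1), h⟩ : Fin n) = f := fun h => by
    rw [hf, Fin.mk.injEq]
    omega
  have hΦ : PhiOf n r₂ k hrn u ⟨k - 1, by omega⟩ = (u f l).coeff 1 := by
    rw [PhiOf, hfi, hl]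
  have hζ : ZetaOf n r₁ r₂ k hr1 hrr hrn hk u ⟨k - 1, by omega⟩ = (u f l).coeff 2 := by
    rw [ZetaOf, dif_pos rfl, hf, hl]
  simp only [xiOf]
  rw [blockEmbed_ymat hr1 hrr hrn hk, sub_add_cancel, hΦ, hζ, ← hl, ← hf]
  congr 1
  · ext1 i
    simp only [extendMid, PhiOf, hf, hl, Fin.lt_def]
    split_ifs with h
    · congr 2
      rw [Fin.ext_iff]
      simp only
      omega
    · rfl
  · ext1 i
    simp only [extendMid, ZetaOf, hf, hl, Fin.lt_def]
    split_ifs with h h'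
    · omega
    · congr 3
      rw [Fin.ext_iff]
      simp only
      omega
    · rfl

theorem PhiOf_last_eq (hr1 : 1 ≤ r₁) (hrr : r₁ ≤ r₂) (hrn : r₂ < n) (hk : k = r₂ - r₁ + 1)
    (u : Matrix (Fin n) (Fin n) K) :
    PhiOf n r₂ k hrn u ⟨k - 1, by omega⟩ = (u ⟨r₁ - 1, by omega⟩ ⟨r₂, hrn⟩).coeff 1 := by
  have h : (⟨r₂ - 1 - (k - 1), by omega⟩ : Fin n) = ⟨r₁ - 1, by omega⟩ := by
    rw [Fin.mk.injEq]
    omega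
  rw [PhiOf, h]

end Embedding

/-- The multiplication map `m(y₁,y₂) = π(y₁·y₂)` and the map
`F_α(y) = (ξ_α(y), π(ξ_α(y)⁻¹·y))` are well-defined mutually inverse bijections
between `Gr⁰_{−α} × Gr_{μ+α}` and the locus `{y ∈ Gr_μ : Φ_{α,k}(y) ≠ 0}`. -/
theorem statement15 (n r₁ r₂ k : ℕ) (hn : 2 ≤ n) (hr1 : 1 ≤ r₁) (hrr : r₁ ≤ r₂)
    (hrn : r₂ < n) (hk : k = r₂ - r₁ + 1) (μ : Fin n → ℤ) :
    -- `m` is well-defined into the locus, and `F_α ∘ m = id`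
    (∀ y₁ ∈ GrZeroNegAlpha n r₁ k, ∀ y₂ ∈ GrSlice (addAlpha n r₁ r₂ μ),
      IsPiOf μ (y₁ * y₂) (piF μ (y₁ * y₂)) ∧
      piF μ (y₁ * y₂) ∈ GrSlice μ ∧
      PhiF n r₂ k hrn μ (piF μ (y₁ * y₂)) ⟨k - 1, by omega⟩ ≠ 0 ∧
      xiF n r₁ r₂ k hr1 hrr hrn hk μ (piF μ (y₁ * y₂)) = y₁ ∧
      piF (addAlpha n r₁ r₂ μ)
          ((xiF n r₁ r₂ k hr1 hrr hrn hk μ (piF μ (y₁ * y₂)))⁻¹ * piF μ (y₁ * y₂))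
        = y₂) ∧
    -- `F_α` is well-defined, and `m ∘ F_α = id`
    (∀ y ∈ GrSlice μ, PhiF n r₂ k hrn μ y ⟨k - 1, by omega⟩ ≠ 0 →
      xiF n r₁ r₂ k hr1 hrr hrn hk μ y ∈ GrZeroNegAlpha n r₁ k ∧
      IsPiOf (addAlpha n r₁ r₂ μ) ((xiF n r₁ r₂ k hr1 hrr hrn hk μ y)⁻¹ * y)
        (piF (addAlpha n r₁ r₂ μ) ((xiF n r₁ r₂ k hr1 hrr hrn hk μ y)⁻¹ * y)) ∧
      piF (addAlpha n r₁ r₂ μ) ((xiF n r₁ r₂ k hr1 hrr hrn hk μ y)⁻¹ * y)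
        ∈ GrSlice (addAlpha n r₁ r₂ μ) ∧
      piF μ (xiF n r₁ r₂ k hr1 hrr hrn hk μ y *
          piF (addAlpha n r₁ r₂ μ) ((xiF n r₁ r₂ k hr1 hrr hrn hk μ y)⁻¹ * y))
        = y) := by
  set f : Fin n := ⟨r₁ - 1, by omega⟩ with hf
  set l : Fin n := ⟨r₂, hrn⟩ with hl
  have hfl : f < l := by
    rw [hf, hl, Fin.mk_lt_mk]
    omega
  have hν : addAlpha n r₁ r₂ μ = μ + rootCoweight f l := by
    ext1 i
    rw [addAlpha, alphaCo_eq_rootCoweight hr1 hrr hrn, Pi.add_apply]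
  have hext : ∀ (v : Fin (k - 1) → ℂ) (i : Fin n), ¬ (f < i ∧ i < l) →
      extendMid n r₁ r₂ k hr1 hrr hk v i = 0 := fun v i h => dif_neg h
  refine ⟨?_, fun y hy hΦ => ?_⟩
  · rintro y₁ ⟨p, e, b, g, he, rfl⟩ y₂ hy₂
    rw [blockEmbed_ymat hr1 hrr hrn hk, ← hf, ← hl]
    obtain ⟨z, u, h, m, H, h1, h2, h3, h4, h5⟩ :=
      exists_isPiOf_sliceMat_mul (c := p + ∑ i, b i * g i) hfl he (hext b) (hext g) hν hy₂
    have hξ : xiF n r₁ r₂ k hr1 hrr hrn hk μ z = sliceMat f l (p + ∑ i, b i * g i) e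
        (extendMid n r₁ r₂ k hr1 hrr hk b) (extendMid n r₁ r₂ k hr1 hrr hk g) := by
      rw [xiF, H.gaussUF_eq, xiOf_eq_sliceMat hr1 hrr hrn hk hf hl, h3, h4,
        mul_div_cancel_right₀ _ he]
      congr 1 <;> ext1 i <;> split_ifs with hi
      · exact (h5 i hi.1 hi.2).1
      · exact (hext b i hi).symm
      · rw [(h5 i hi.1 hi.2).2, mul_div_cancel_left₀ _ he]
      · exact (hext g i hi).symm
    rw [h1.piF_eq, hξ, inv_eq_right_inv (sliceMat_mul_sliceInv hfl he (hext b) (hext g)), h2.piF_eq]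
    refine ⟨h1, h1.1, ?_, rfl, rfl⟩
    rwa [PhiF, H.gaussUF_eq, PhiOf_last_eq hr1 hrr hrn hk, h3]
  · have hy' := hy
    obtain ⟨u, h, m, H⟩ := hy'
    have he := hΦ
    rw [PhiF, H.gaussUF_eq, PhiOf_last_eq hr1 hrr hrn hk, ← hf, ← hl] at he
    have hmem : xiF n r₁ r₂ k hr1 hrr hrn hk μ y ∈ GrZeroNegAlpha n r₁ k :=
      ⟨_, _, _, _, hΦ, rfl⟩
    have hb : ∀ (v : Fin n → ℂ) (i : Fin n), ¬ (f < i ∧ i < l) →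
        (if f < i ∧ i < l then v i else 0) = 0 := fun v i h => if_neg h
    obtain ⟨z, h1, h2⟩ := exists_isPiOf_sliceInv_mul
      (c := (u f l).coeff 2 / (u f l).coeff 1) hfl he (hb fun i => (u i l).coeff 1)
      (hb fun i => (u f i).coeff 1 / (u f l).coeff 1) hν H rfl
      (div_mul_cancel₀ _ he).symm
      (fun i h h' => (if_pos ⟨h, h'⟩).symm)
      (fun i h h' => by rw [if_pos ⟨h, h'⟩, mul_div_cancel₀ _ he])
    refine ⟨hmem, ?_⟩
    rw [xiF, H.gaussUF_eq, xiOf_eq_sliceMat hr1 hrr hrn hk hf hl,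
      inv_eq_right_inv (sliceMat_mul_sliceInv hfl he (hb fun i => (u i l).coeff 1)
        (hb fun i => (u f i).coeff 1 / (u f l).coeff 1)), h1.piF_eq, h2.piF_eq]
    exact ⟨h1, h1.1, rfl⟩

end
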